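/- arXiv:2002.02500 — 3 statements merged into one kernel-verified Lean document; each statement's English description precedes it below -/
import Mathlib

section
/- Let c > 0. If λ₀ is a real number that is an eigenvalue of H_t(c) for some t ∈ [0,1], then there exists a real number μ with μ ≤ λ₀ such that μ is an eigenvalue of H_0(c) (a real periodic eigenvalue). In other words, the part of the spectrum of H(c) lying to the left of the smallest real periodic eigenvalue is nonreal. -/
/-- `lam` is an eigenvalue of the Mathieu-type operator `H_t(c)` with potential
`2ic·cos(2x)` on `[0,π]`, with boundary conditions `y(π) = e^{iπt} y(0)`,
`y'(π) = e^{iπt} y'(0)`. -/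
def mathieuEV (c t : ℝ) (lam : ℂ) : Prop :=
  ∃ y : ℝ → ℂ, ContDiff ℝ 2 y ∧ (∃ x ∈ Set.Icc (0 : ℝ) Real.pi, y x ≠ 0) ∧
    (∀ x ∈ Set.Icc (0 : ℝ) Real.pi,
      -(deriv (deriv y) x) + 2 * Complex.I * (c : ℂ) * Complex.cos (2 * (x : ℂ)) * y x
        = lam * y x) ∧
    y Real.pi = Complex.exp (Complex.I * (Real.pi : ℂ) * (t : ℂ)) * y 0 ∧
    deriv y Real.pi = Complex.exp (Complex.I * (Real.pi : ℂ) * (t : ℂ)) * deriv y 0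

open Set MeasureTheory
open scoped Interval

section general
set_option linter.unusedSectionVars false
variable {E : Type*} [NormedAddCommGroup E] [NormedSpace ℝ E]

noncomputable def picPhi (A : ℝ → E →L[ℝ] E) (v : E) : ℕ → ℝ → E
  | 0 => fun _ => v
  | n+1 => fun x => ∫ s in (0:ℝ)..x, A s (picPhi A v n s)

noncomputable def picSol (A : ℝ → E →L[ℝ] E) (v : E) (x : ℝ) : E :=
  v + ∑' n, picPhi A v (n+1) x

lemma picPhi_cont {P : Type*} [TopologicalSpace P] [FirstCountableTopology P] [LocallyCompactSpace P] (A : P → ℝ → E →L[ℝ] E)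
    (hA : Continuous (fun z : P × ℝ => A z.1 z.2)) (v : E) (n : ℕ) :
    Continuous (fun z : P × ℝ => picPhi (A z.1) v n z.2) := by
  induction n with
  | zero => exact continuous_const
  | succ n ih =>
    simp only [picPhi]
    have : Continuous (Function.uncurry fun (z : P × ℝ) (s : ℝ) => A z.1 s (picPhi (A z.1) v n s)) := by
      have h1 : Continuous (fun w : (P × ℝ) × ℝ => ((w.1.1, w.2) : P × ℝ)) := by fun_prop
      exact (hA.comp h1).clm_apply (ih.comp h1)
    exact intervalIntegral.continuous_parametric_intervalIntegral_of_continuous this continuous_snd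

lemma picPhi_bound (A : ℝ → E →L[ℝ] E) (hA : Continuous A) (v : E) {K : ℝ} (hK : ∀ s, ‖A s‖ ≤ K) (n : ℕ) (x : ℝ) :
    ‖picPhi A v n x‖ ≤ ‖v‖ * ((K * |x|) ^ n / n.factorial) := by
  have hK0 : 0 ≤ K := (norm_nonneg _).trans (hK 0)
  induction n generalizing x with
  | zero => simp [picPhi]
  | succ n ih =>
    simp only [picPhi]
    calc ‖∫ s in (0:ℝ)..x, A s (picPhi A v n s)‖
        ≤ ∫ s in Ι 0 x, ‖A s (picPhi A v n s)‖ := intervalIntegral.norm_integral_le_integral_norm_uIoc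
      _ ≤ ∫ s in Ι 0 x, (K * ‖v‖ * K ^ n / n.factorial) * |s - 0| ^ n := by
        apply MeasureTheory.integral_mono_of_nonneg
        · exact Filter.Eventually.of_forall fun s => norm_nonneg _
        · rw [← IntegrableOn, ← intervalIntegrable_iff]
          exact Continuous.intervalIntegrable (by fun_prop) _ _
        · refine Filter.Eventually.of_forall fun s => ?_
          calc ‖A s (picPhi A v n s)‖ ≤ ‖A s‖ * ‖picPhi A v n s‖ := (A s).le_opNorm _
            _ ≤ K * (‖v‖ * ((K * |s|) ^ n / n.factorial)) :=
              mul_le_mul (hK s) (ih s) (norm_nonneg _) hK0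
            _ = (K * ‖v‖ * K ^ n / n.factorial) * |s - 0| ^ n := by rw [sub_zero, mul_pow]; ring
      _ = _ := by
        rw [MeasureTheory.integral_const_mul, integral_pow_abs_sub_uIoc]
        rw [Nat.factorial_succ, mul_pow]; push_cast; rw [sub_zero]
        field_simp
        ring

lemma picSummable (v : E) (K R : ℝ) : Summable (fun n : ℕ => ‖v‖ * ((K * R) ^ n / n.factorial)) :=
  (Real.summable_pow_div_factorial _).mul_left _

lemma picSol_zero (A : ℝ → E →L[ℝ] E) (v : E) : picSol A v 0 = v := by
  simp [picSol, picPhi]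

lemma picBoundR (v : E) {K R x : ℝ} (hK : 0 ≤ K) (hx : |x| ≤ R) (n : ℕ) :
    ‖v‖ * ((K * |x|) ^ n / n.factorial) ≤ ‖v‖ * ((K * R) ^ n / n.factorial) := by
  gcongr

variable [CompleteSpace E]

lemma picSol_hasDerivAt (A : ℝ → E →L[ℝ] E) (hA : Continuous A) (v : E) {K : ℝ} (hK : ∀ s, ‖A s‖ ≤ K) (x : ℝ) :
    HasDerivAt (picSol A v) (A x (picSol A v x)) x := by
  have hK0 : 0 ≤ K := (norm_nonneg _).trans (hK 0)
  have hc : ∀ n, Continuous (picPhi A v n) := fun n => by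
    have := picPhi_cont (P := Unit) (fun _ => A) (hA.comp continuous_snd) v n
    exact this.comp (by fun_prop : Continuous fun x : ℝ => ((), x))
  have hs : ∀ y, Summable (fun n => picPhi A v n y) := fun y =>
    Summable.of_norm_bounded (picSummable v K |y|) (fun n => picPhi_bound A hA v hK n y)
  have hd : ∀ n y, HasDerivAt (picPhi A v (n+1)) (A y (picPhi A v n y)) y := fun n y => by
    have hcc : Continuous fun s => A s (picPhi A v n s) := hA.clm_apply (hc n)
    exact intervalIntegral.integral_hasDerivAt_right (hcc.intervalIntegrable _ _)
      (hcc.stronglyMeasurableAtFilter _ _) hcc.continuousAt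
  have key := hasDerivAt_tsum_of_isPreconnected (𝕜 := ℝ)
    (u := fun n : ℕ => K * (‖v‖ * ((K * (|x|+1)) ^ n / n.factorial)))
    (g := fun n y => picPhi A v (n+1) y) (g' := fun n y => A y (picPhi A v n y))
    (t := Metric.ball (0:ℝ) (|x|+1)) (y₀ := x) (y := x)
    ((picSummable v K (|x|+1)).mul_left K) Metric.isOpen_ball
    (convex_ball _ _).isPreconnected (fun n y _ => hd n y)
    (fun n y hy => by
      have hy' : |y| ≤ |x| + 1 := by
        have := mem_ball_zero_iff.1 hy
        exact this.le
      calc ‖A y (picPhi A v n y)‖ ≤ ‖A y‖ * ‖picPhi A v n y‖ := (A y).le_opNorm _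
        _ ≤ _ := mul_le_mul (hK y) ((picPhi_bound A hA v hK n y).trans (picBoundR v hK0 hy' n)) (norm_nonneg _) hK0)
    (by simp) ((summable_nat_add_iff 1).2 (hs x)) (by simp)
  have e : ∑' n, A x (picPhi A v n x) = A x (picSol A v x) := by
    rw [← (A x).map_tsum (hs x), (hs x).tsum_eq_zero_add]; rfl
  rw [e] at key
  exact key.const_add v

lemma picSol_cont {P : Type*} [TopologicalSpace P] [FirstCountableTopology P] [LocallyCompactSpace P] (A : P → ℝ → E →L[ℝ] E)
    (hA : Continuous (fun z : P × ℝ => A z.1 z.2)) (v : E) {K : ℝ} (hK : ∀ p s, ‖A p s‖ ≤ K) (x : ℝ) :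
    Continuous (fun p => picSol (A p) v x) := by
  unfold picSol
  refine continuous_const.add (continuous_tsum (u := fun n : ℕ => ‖v‖ * ((K * |x|) ^ (n+1) / (n+1).factorial)) ?_ ?_ ?_)
  · intro n
    exact (picPhi_cont A hA v (n+1)).comp (by fun_prop : Continuous fun p : P => (p, x))
  · exact (summable_nat_add_iff 1).2 (picSummable v K |x|)
  · intro n p
    exact picPhi_bound (A p) (hA.comp (by fun_prop : Continuous fun s : ℝ => (p, s))) v (hK p) (n+1) x

lemma lin_unique (A : ℝ → E →L[ℝ] E) {K L : ℝ} (hK : ∀ s, ‖A s‖ ≤ K) {Y Z : ℝ → E}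
    (hY : ∀ x ∈ Icc 0 L, HasDerivAt Y (A x (Y x)) x) (hZ : ∀ x ∈ Icc 0 L, HasDerivAt Z (A x (Z x)) x)
    (h0 : Y 0 = Z 0) : ∀ x ∈ Icc 0 L, Y x = Z x := by
  have hD : ∀ x ∈ Icc 0 L, HasDerivAt (fun x => Y x - Z x) (A x (Y x - Z x)) x := fun x hx => by
    rw [map_sub]; exact (hY x hx).sub (hZ x hx)
  have := eq_zero_of_abs_deriv_le_mul_abs_self_of_eq_zero_right (f := fun x => Y x - Z x) (f' := fun x => A x (Y x - Z x)) (K := K) (a := 0) (b := L)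
    (fun x hx => (hD x hx).continuousAt.continuousWithinAt)
    (fun x hx => (hD x (Ico_subset_Icc_self hx)).hasDerivWithinAt)
    (by simp [h0]) (fun x _ => ((A x).le_opNorm _).trans (by gcongr; exact hK x))
  intro x hx
  exact sub_eq_zero.1 (this x hx)

end general

section concrete
open Complex ComplexConjugate

noncomputable def qQ (c l x : ℝ) : ℂ := 2 * I * (c : ℂ) * Complex.cos (2 * (x : ℂ)) - (l : ℂ)

noncomputable def matS : ℂ × ℂ →L[ℝ] ℂ × ℂ :=
  (ContinuousLinearMap.inl ℝ ℂ ℂ).comp (ContinuousLinearMap.snd ℝ ℂ ℂ)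
noncomputable def matT : ℂ × ℂ →L[ℝ] ℂ × ℂ :=
  (ContinuousLinearMap.inr ℝ ℂ ℂ).comp (ContinuousLinearMap.fst ℝ ℂ ℂ)
noncomputable def matA (q : ℂ) : ℂ × ℂ →L[ℝ] ℂ × ℂ := matS + q • matT

lemma matA_apply (q : ℂ) (v : ℂ × ℂ) : matA q v = (v.2, q * v.1) := by
  ext <;> simp [matA, matS, matT]

lemma qQ_cont : Continuous (fun z : (ℝ × ℝ) × ℝ => qQ z.1.1 z.1.2 z.2) := by
  unfold qQ; fun_prop

lemma qQ_bound (c l x : ℝ) : ‖qQ c l x‖ ≤ 2 * |c| + |l| := by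
  unfold qQ
  refine (norm_sub_le _ _).trans ?_
  have h : Complex.cos (2 * (x : ℂ)) = ((Real.cos (2 * x) : ℝ) : ℂ) := by push_cast; rfl
  rw [h]
  simp only [norm_mul, Complex.norm_real, Complex.norm_I, Complex.norm_ofNat, Real.norm_eq_abs, mul_one]
  have := Real.abs_cos_le_one (2 * x)
  nlinarith [abs_nonneg c]

lemma matA_bound (c l x : ℝ) : ‖matA (qQ c l x)‖ ≤ ‖matS‖ + (2 * |c| + |l|) * ‖matT‖ := by
  unfold matA
  refine (norm_add_le _ _).trans ?_
  rw [norm_smul]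
  gcongr
  exact qQ_bound c l x

lemma matA_cont : Continuous (fun z : (ℝ × ℝ) × ℝ => matA (qQ z.1.1 z.1.2 z.2)) := by
  unfold matA
  exact continuous_const.add (qQ_cont.smul continuous_const)

noncomputable def sl (c l : ℝ) (v : ℂ × ℂ) (x : ℝ) : ℂ × ℂ :=
  picSol (fun s => matA (qQ c l s)) v x

lemma sl_zero (c l : ℝ) (v : ℂ × ℂ) : sl c l v 0 = v := picSol_zero _ _

lemma sl_deriv (c l : ℝ) (v : ℂ × ℂ) (x : ℝ) :
    HasDerivAt (sl c l v) (matA (qQ c l x) (sl c l v x)) x :=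
  picSol_hasDerivAt _ (matA_cont.comp (by fun_prop : Continuous fun s : ℝ => ((c, l), s))) v
    (matA_bound c l) x

lemma sl_cont_gen {P : Type*} [TopologicalSpace P] [FirstCountableTopology P] [LocallyCompactSpace P]
    (f : P → ℝ × ℝ) (hf : Continuous f) (C L : ℝ) (h1 : ∀ p, |(f p).1| ≤ C) (h2 : ∀ p, |(f p).2| ≤ L)
    (v : ℂ × ℂ) (x : ℝ) : Continuous (fun p => sl (f p).1 (f p).2 v x) := by
  unfold sl
  have k1 : Continuous (fun z : P × ℝ => matA (qQ (f z.1).1 (f z.1).2 z.2)) := by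
    have k0 : Continuous (fun z : P × ℝ => qQ (f z.1).1 (f z.1).2 z.2) := by
      unfold qQ; fun_prop
    unfold matA
    exact continuous_const.add (k0.smul continuous_const)
  have k2 : ∀ (p : P) (s : ℝ), ‖matA (qQ (f p).1 (f p).2 s)‖ ≤ ‖matS‖ + (2 * C + L) * ‖matT‖ := by
    intro p s
    refine (matA_bound _ _ _).trans ?_
    have h3 := h1 p
    have h4 := h2 p
    have h5 := norm_nonneg matT
    have h6 : 2 * |(f p).1| + |(f p).2| ≤ 2 * C + L := by linarith
    have h7 := mul_le_mul_of_nonneg_right h6 h5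
    linarith
  exact picSol_cont (fun (p : P) (s : ℝ) => matA (qQ (f p).1 (f p).2 s)) k1 v k2 x

lemma sl_cont (C L : ℝ) (v : ℂ × ℂ) (x : ℝ) :
    ContinuousOn (fun p : ℝ × ℝ => sl p.1 p.2 v x) (Icc (-C) C ×ˢ Icc (-L) L) := by
  rw [continuousOn_iff_continuous_domRestrict]
  have : LocallyCompactSpace ↥(Icc (-C) C ×ˢ Icc (-L) L) :=
    (isClosed_Icc.prod isClosed_Icc).isClosedEmbedding_subtypeVal.locallyCompactSpace
  exact sl_cont_gen (Subtype.val : ↥(Icc (-C) C ×ˢ Icc (-L) L) → ℝ × ℝ) continuous_subtype_val C L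
    (fun p => abs_le.2 p.2.1) (fun p => abs_le.2 p.2.2) v x

def IsSl (c l L : ℝ) (Y : ℝ → ℂ × ℂ) : Prop :=
  ∀ x ∈ Icc 0 L, HasDerivAt Y (matA (qQ c l x) (Y x)) x

lemma isSl_unique {c l L : ℝ} {Y Z : ℝ → ℂ × ℂ} (hY : IsSl c l L Y) (hZ : IsSl c l L Z)
    (h : Y 0 = Z 0) : ∀ x ∈ Icc 0 L, Y x = Z x :=
  lin_unique _ (matA_bound c l) hY hZ h

lemma sl_lin {c l L : ℝ} (hL : 0 ≤ L) {Y : ℝ → ℂ × ℂ} (hY : IsSl c l L Y) :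
    Y L = (Y 0).1 • sl c l (1, 0) L + (Y 0).2 • sl c l (0, 1) L := by
  refine isSl_unique (Z := fun x => (Y 0).1 • sl c l (1, 0) x + (Y 0).2 • sl c l (0, 1) x) hY ?_ ?_ L ⟨hL, le_rfl⟩
  · intro x hx
    have := ((sl_deriv c l (1, 0) x).const_smul (Y 0).1).add ((sl_deriv c l (0, 1) x).const_smul (Y 0).2)
    refine this.congr_deriv ?_
    rw [matA_apply, matA_apply, matA_apply]
    ext1
    · simp
    · simp; ring
  · simp [sl_zero]

lemma qQ_shift (c l x : ℝ) : qQ c l (x + Real.pi / 2) = conj (qQ c l x) := by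
  unfold qQ
  have h : Complex.cos (2 * (x : ℂ)) = ((Real.cos (2 * x) : ℝ) : ℂ) := by push_cast; rfl
  have h2 : Complex.cos (2 * ((x + Real.pi / 2 : ℝ) : ℂ)) = ((-Real.cos (2 * x) : ℝ) : ℂ) := by
    rw [← Real.cos_add_pi]; push_cast; congr 1; ring
  rw [h, h2]
  simp only [map_sub, map_mul, conj_I, conj_ofReal, map_ofNat, ofReal_neg]
  ring

noncomputable def conjP : ℂ × ℂ →L[ℝ] ℂ × ℂ :=
  (conjCLE : ℂ →L[ℝ] ℂ).prodMap (conjCLE : ℂ →L[ℝ] ℂ)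

lemma conjP_apply (v : ℂ × ℂ) : conjP v = (conj v.1, conj v.2) := by
  rfl

lemma isSl_shift {c l : ℝ} {Y : ℝ → ℂ × ℂ} (hY : IsSl c l Real.pi Y) :
    IsSl c l (Real.pi / 2) (fun x => conjP (Y (x + Real.pi / 2))) := by
  intro x hx
  have h1 := hY (x + Real.pi / 2) ⟨by linarith [hx.1, Real.pi_pos], by linarith [hx.2]⟩
  have h2 := conjP.hasFDerivAt.comp_hasDerivAt x (h1.comp_add_const x (Real.pi / 2))
  refine h2.congr_deriv ?_
  rw [matA_apply, matA_apply, conjP_apply, qQ_shift]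
  simp [conjP_apply]

noncomputable def ea (c l : ℝ) : ℂ := (sl c l (1, 0) (Real.pi / 2)).1
noncomputable def eb (c l : ℝ) : ℂ := (sl c l (0, 1) (Real.pi / 2)).1
noncomputable def ec (c l : ℝ) : ℂ := (sl c l (1, 0) (Real.pi / 2)).2
noncomputable def ed (c l : ℝ) : ℂ := (sl c l (0, 1) (Real.pi / 2)).2

noncomputable def m11 (c l : ℝ) : ℂ := conj (ea c l) * ea c l + conj (eb c l) * ec c l
noncomputable def m12 (c l : ℝ) : ℂ := conj (ea c l) * eb c l + conj (eb c l) * ed c l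
noncomputable def m21 (c l : ℝ) : ℂ := conj (ec c l) * ea c l + conj (ed c l) * ec c l
noncomputable def m22 (c l : ℝ) : ℂ := conj (ec c l) * eb c l + conj (ed c l) * ed c l

lemma mono {c l : ℝ} {Y : ℝ → ℂ × ℂ} (hY : IsSl c l Real.pi Y) :
    Y Real.pi = (m11 c l * (Y 0).1 + m12 c l * (Y 0).2, m21 c l * (Y 0).1 + m22 c l * (Y 0).2) := by
  have hp := Real.pi_pos
  have h1 := sl_lin (L := Real.pi / 2) (by positivity) (Y := Y) (fun x hx => hY x ⟨hx.1, by linarith [hx.2]⟩)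
  have h2 := sl_lin (L := Real.pi / 2) (by positivity) (isSl_shift hY)
  simp only [zero_add, add_halves, conjP_apply] at h2
  have h11 := congrArg Prod.fst h1
  have h12 := congrArg Prod.snd h1
  have h21 := congrArg (conj ∘ Prod.fst) h2
  have h22 := congrArg (conj ∘ Prod.snd) h2
  simp only [Function.comp, Prod.fst_add, Prod.snd_add, Prod.smul_fst, Prod.smul_snd, smul_eq_mul, map_add, map_mul, conj_conj] at h11 h12 h21 h22
  rw [h11, h12] at h21 h22
  ext1
  · rw [h21]; simp only [m11, m12, ea, eb, ec, ed]; ring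
  · rw [h22]; simp only [m21, m22, ea, eb, ec, ed]; ring

lemma wronsk (c l : ℝ) : ea c l * ed c l - eb c l * ec c l = 1 := by
  have hd : ∀ x, HasDerivAt (fun x => (sl c l (1,0) x).1 * (sl c l (0,1) x).2 - (sl c l (0,1) x).1 * (sl c l (1,0) x).2) 0 x := by
    intro x
    have h1 := sl_deriv c l (1,0) x
    have h2 := sl_deriv c l (0,1) x
    rw [matA_apply] at h1 h2
    have h11 : HasDerivAt (fun x => (sl c l (1,0) x).1) _ x := h1.fst
    have h12 : HasDerivAt (fun x => (sl c l (1,0) x).2) _ x := h1.snd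
    have h21 : HasDerivAt (fun x => (sl c l (0,1) x).1) _ x := h2.fst
    have h22 : HasDerivAt (fun x => (sl c l (0,1) x).2) _ x := h2.snd
    refine ((h11.mul h22).sub (h21.mul h12)).congr_deriv ?_
    ring
  have := is_const_of_deriv_eq_zero (fun x => (hd x).differentiableAt) (fun x => (hd x).deriv) (Real.pi/2) 0
  simp only [sl_zero] at this
  simpa [ea, eb, ec, ed] using this

noncomputable def FF (c l : ℝ) : ℝ :=
  normSq (ea c l) + normSq (ed c l) + 2 * (eb c l * conj (ec c l)).re

lemma FF_eq (c l : ℝ) : (FF c l : ℂ) = m11 c l + m22 c l := by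
  have h : ((2 * (eb c l * conj (ec c l)).re : ℝ) : ℂ) = eb c l * conj (ec c l) + conj (eb c l) * ec c l := by
    rw [← Complex.add_conj]; simp
  unfold FF
  rw [ofReal_add, ofReal_add, h, normSq_eq_conj_mul_self, normSq_eq_conj_mul_self]
  unfold m11 m22; ring

lemma det_one (c l : ℝ) : m11 c l * m22 c l - m12 c l * m21 c l = 1 := by
  have h := wronsk c l
  have h2 := congrArg conj h
  simp only [map_sub, map_mul, map_one] at h2
  have : m11 c l * m22 c l - m12 c l * m21 c l =
    (ea c l * ed c l - eb c l * ec c l) * (conj (ea c l) * conj (ed c l) - conj (eb c l) * conj (ec c l)) := by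
    unfold m11 m12 m21 m22; ring
  rw [this, h, h2, one_mul]

lemma isSl_of_ev {c l : ℝ} {y : ℝ → ℂ} (hy : ContDiff ℝ 2 y)
    (h : ∀ x ∈ Icc (0 : ℝ) Real.pi,
      -(deriv (deriv y) x) + 2 * Complex.I * (c : ℂ) * Complex.cos (2 * (x : ℂ)) * y x
        = (l : ℂ) * y x) : IsSl c l Real.pi (fun x => (y x, deriv y x)) := by
  intro x hx
  have h1 : HasDerivAt y (deriv y x) x := (hy.differentiable (by norm_num) x).hasDerivAt
  have hy' : ContDiff ℝ 1 (deriv y) := by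
    have := (contDiff_succ_iff_deriv (n := 1) (f := y)).1 (by rw [one_add_one_eq_two]; exact hy)
    exact this.2.2
  have h2 : HasDerivAt (deriv y) (deriv (deriv y) x) x := (hy'.differentiable (by norm_num) x).hasDerivAt
  rw [matA_apply]
  convert h1.prodMk h2 using 1
  ext1
  · rfl
  · simp only [qQ]; linear_combination (h x hx)

lemma FF_le {c t l : ℝ} (h : mathieuEV c t (l : ℂ)) : FF c l ≤ 2 := by
  obtain ⟨y, hy, ⟨x0, hx0, hne⟩, hode, hb1, hb2⟩ := h
  have hs := isSl_of_ev hy hode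
  have hm := mono hs
  have hv : ¬ (y 0 = 0 ∧ deriv y 0 = 0) := by
    rintro ⟨h1, h2⟩
    have := isSl_unique (Z := fun _ => 0) hs (fun x _ => by simpa using hasDerivAt_const x (0 : ℂ × ℂ)) (by simp [h1, h2]) x0 hx0
    exact hne (congrArg Prod.fst this)
  have e1 := congrArg Prod.fst hm
  have e2 := congrArg Prod.snd hm
  simp only [hb1, hb2] at e1 e2
  have hr : ‖Complex.exp (I * (Real.pi : ℂ) * (t : ℂ))‖ = 1 := by
    have := Complex.norm_exp_ofReal_mul_I (Real.pi * t)
    rw [← this]; congr 2; push_cast; ring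
  set r := Complex.exp (I * (Real.pi : ℂ) * (t : ℂ))
  have hdet := det_one c l
  have hF := FF_eq c l
  have key : r ^ 2 - (FF c l : ℂ) * r + 1 = 0 := by
    rw [hF]
    by_cases h1 : y 0 = 0
    · have h2 : deriv y 0 ≠ 0 := fun h2 => hv ⟨h1, h2⟩
      apply mul_right_cancel₀ h2
      linear_combination (r - m11 c l) * e2 + m21 c l * e1 - deriv y 0 * hdet
    · apply mul_right_cancel₀ h1
      linear_combination (r - m22 c l) * e1 + m12 c l * e2 - y 0 * hdet
  have hrr : r * conj r = 1 := by
    rw [Complex.mul_conj, Complex.normSq_eq_norm_sq, hr]; norm_num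
  have k2 : (FF c l : ℂ) = r + conj r := by
    linear_combination (-conj r) * key + (r - (FF c l : ℂ)) * hrr
  rw [Complex.add_conj] at k2
  have k3 : FF c l = 2 * r.re := by exact_mod_cast k2
  have := Complex.re_le_norm r
  linarith

lemma ev_of_FF {c l : ℝ} (h : FF c l = 2) : mathieuEV c 0 (l : ℂ) := by
  have hdet := det_one c l
  have hF := FF_eq c l
  rw [h] at hF
  push_cast at hF
  have hv : ∃ v : ℂ × ℂ, v ≠ 0 ∧ m11 c l * v.1 + m12 c l * v.2 = v.1 ∧ m21 c l * v.1 + m22 c l * v.2 = v.2 := by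
    by_cases h1 : ((m12 c l, 1 - m11 c l) : ℂ × ℂ) = 0
    · have h11 : m12 c l = 0 := congrArg Prod.fst h1
      have h12 : 1 - m11 c l = 0 := congrArg Prod.snd h1
      by_cases h2 : ((1 - m22 c l, m21 c l) : ℂ × ℂ) = 0
      · have h21 : 1 - m22 c l = 0 := congrArg Prod.fst h2
        have h22 : m21 c l = 0 := congrArg Prod.snd h2
        refine ⟨(1, 0), by simp, ?_, ?_⟩
        · simp; linear_combination -h12
        · simp [h22]
      · refine ⟨_, h2, ?_, ?_⟩
        · simp only; linear_combination hdet - hF + 0 * h11 - 0 * h12 + (2 * m21 c l) * h11 - (1 - m22 c l) * h12 - (hdet - hF + m21 c l * h11)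
        · simp only; ring
    · refine ⟨_, h1, ?_, ?_⟩
      · simp only; ring
      · simp only; linear_combination -hdet - hF
  obtain ⟨v, hv0, hv1, hv2⟩ := hv
  have hm := mono (c := c) (l := l) (Y := sl c l v) (fun x _ => sl_deriv c l v x)
  rw [sl_zero, hv1, hv2] at hm
  have hd := fun x => sl_deriv c l v x
  simp only [matA_apply] at hd
  have d1 : ∀ x, HasDerivAt (fun x => (sl c l v x).1) (sl c l v x).2 x := fun x => (hd x).fst
  have d2 : ∀ x, HasDerivAt (fun x => (sl c l v x).2) (qQ c l x * (sl c l v x).1) x := fun x => (hd x).snd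
  have D1 : deriv (fun x => (sl c l v x).1) = fun x => (sl c l v x).2 := funext fun x => (d1 x).deriv
  have D2 : deriv (fun x => (sl c l v x).2) = fun x => qQ c l x * (sl c l v x).1 := funext fun x => (d2 x).deriv
  have c1 : Continuous (fun x => (sl c l v x).1) := continuous_iff_continuousAt.2 fun x => (d1 x).continuousAt
  refine ⟨fun x => (sl c l v x).1, ?_, ?_, ?_, ?_, ?_⟩
  · have : ContDiff ℝ 1 (fun x => (sl c l v x).2) := by
      rw [contDiff_one_iff_deriv, D2]
      refine ⟨fun x => (d2 x).differentiableAt, ?_⟩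
      exact (qQ_cont.comp (by fun_prop : Continuous fun s : ℝ => ((c, l), s))).mul c1
    have h2 := (contDiff_succ_iff_deriv (n := 1) (f := fun x => (sl c l v x).1)).2
      ⟨fun x => (d1 x).differentiableAt, by simp, by rw [D1]; exact this⟩
    rw [one_add_one_eq_two] at h2; exact h2
  · by_contra! hcon
    have hz : ∀ x ∈ Icc 0 Real.pi, (sl c l v x).1 = 0 := hcon
    have hp := Real.pi_pos
    have h0 : (0:ℝ) ∈ Icc 0 Real.pi := ⟨le_rfl, hp.le⟩
    have hv1' : v.1 = 0 := by simpa [sl_zero] using hz 0 h0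
    have u := uniqueDiffOn_Icc hp 0 h0
    have w1 := (d1 0).hasDerivWithinAt (s := Icc 0 Real.pi)
    have w2 : HasDerivWithinAt (fun x => (sl c l v x).1) 0 (Icc 0 Real.pi) 0 :=
      (hasDerivWithinAt_const 0 _ (0:ℂ)).congr hz (hz 0 h0)
    have := u.eq_deriv _ w1 w2
    rw [sl_zero] at this
    exact hv0 (Prod.ext hv1' this)
  · intro x _
    rw [D1, D2]; simp only [qQ]; ring
  · simp [hm, sl_zero]
  · simp [D1, hm, sl_zero]

lemma ev_nonneg {c t l : ℝ} (h : mathieuEV c t (l : ℂ)) : 0 ≤ l := by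
  obtain ⟨y, hy, ⟨x0, hx0, hne⟩, hode, hb1, hb2⟩ := h
  have hs := isSl_of_ev hy hode
  by_contra! hl
  have hp := Real.pi_pos
  have hE : ∀ x ∈ Icc 0 Real.pi, HasDerivAt (fun x => (conj (y x) * deriv y x).re)
      (normSq (deriv y x) - l * normSq (y x)) x := by
    intro x hx
    have h1 := hs x hx
    rw [matA_apply] at h1
    have d1 : HasDerivAt y (deriv y x) x := h1.fst
    have d2 : HasDerivAt (deriv y) (qQ c l x * y x) x := h1.snd
    have d3 : HasDerivAt (fun x => conj (y x)) (conj (deriv y x)) x :=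
      (conjCLE : ℂ →L[ℝ] ℂ).hasFDerivAt.comp_hasDerivAt x d1
    have d4 := reCLM.hasFDerivAt.comp_hasDerivAt x (d3.mul d2)
    refine d4.congr_deriv ?_
    have hc : Complex.cos (2 * (x : ℂ)) = ((Real.cos (2 * x) : ℝ) : ℂ) := by push_cast; rfl
    rw [qQ, hc]
    generalize Real.cos (2 * x) = k
    simp [normSq_apply]
    ring
  have hmono : MonotoneOn (fun x => (conj (y x) * deriv y x).re) (Icc 0 Real.pi) := by
    apply monotoneOn_of_hasDerivWithinAt_nonneg (convex_Icc _ _)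
      (f' := fun x => normSq (deriv y x) - l * normSq (y x))
    · exact fun x hx => (hE x hx).continuousAt.continuousWithinAt
    · exact fun x hx => (hE x (interior_subset hx)).hasDerivWithinAt
    · intro x _
      nlinarith [normSq_nonneg (deriv y x), normSq_nonneg (y x)]
  have hr : ‖Complex.exp (I * (Real.pi : ℂ) * (t : ℂ))‖ = 1 := by
    have := Complex.norm_exp_ofReal_mul_I (Real.pi * t)
    rw [← this]; congr 2; push_cast; ring
  set r := Complex.exp (I * (Real.pi : ℂ) * (t : ℂ))
  have hrr : r * conj r = 1 := by
    rw [Complex.mul_conj, Complex.normSq_eq_norm_sq, hr]; norm_num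
  have hper : conj (y Real.pi) * deriv y Real.pi = conj (y 0) * deriv y 0 := by
    rw [hb1, hb2, map_mul]; linear_combination conj (y 0) * deriv y 0 * hrr
  have hconst : ∀ x ∈ Icc 0 Real.pi, (conj (y x) * deriv y x).re = (conj (y 0) * deriv y 0).re := by
    intro x hx
    apply le_antisymm
    · have := hmono hx ⟨hp.le, le_rfl⟩ hx.2
      simpa only [hper] using this
    · exact hmono ⟨le_rfl, hp.le⟩ hx hx.1
  have w2 : HasDerivWithinAt (fun x => (conj (y x) * deriv y x).re) 0 (Icc 0 Real.pi) x0 :=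
    (hasDerivWithinAt_const x0 _ _).congr hconst (hconst x0 hx0)
  have := (uniqueDiffOn_Icc hp x0 hx0).eq_deriv _ (hE x0 hx0).hasDerivWithinAt w2
  have h1 := normSq_pos.2 hne
  nlinarith [normSq_nonneg (deriv y x0)]

lemma FF_cont (C L : ℝ) : ContinuousOn (fun p : ℝ × ℝ => FF p.1 p.2) (Icc (-C) C ×ˢ Icc (-L) L) := by
  have h1 := sl_cont C L (1, 0) (Real.pi / 2)
  have h2 := sl_cont C L (0, 1) (Real.pi / 2)
  have ha : ContinuousOn (fun p : ℝ × ℝ => ea p.1 p.2) (Icc (-C) C ×ˢ Icc (-L) L) := h1.fst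
  have hb : ContinuousOn (fun p : ℝ × ℝ => eb p.1 p.2) (Icc (-C) C ×ˢ Icc (-L) L) := h2.fst
  have hc : ContinuousOn (fun p : ℝ × ℝ => ec p.1 p.2) (Icc (-C) C ×ˢ Icc (-L) L) := h1.snd
  have hd : ContinuousOn (fun p : ℝ × ℝ => ed p.1 p.2) (Icc (-C) C ×ˢ Icc (-L) L) := h2.snd
  unfold FF
  exact ((continuous_normSq.comp_continuousOn ha).add (continuous_normSq.comp_continuousOn hd)).add
    (continuousOn_const.mul (continuous_re.comp_continuousOn (hb.mul (continuous_conj.comp_continuousOn hc))))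

lemma FF_zero : 2 < FF 0 (-1) := by
  have hp := Real.pi_pos
  have hch : ∀ x : ℝ, HasDerivAt (fun x : ℝ => ((Real.cosh x : ℝ) : ℂ)) ((Real.sinh x : ℝ) : ℂ) x :=
    fun x => (Real.hasDerivAt_cosh x).ofReal_comp
  have hsh : ∀ x : ℝ, HasDerivAt (fun x : ℝ => ((Real.sinh x : ℝ) : ℂ)) ((Real.cosh x : ℝ) : ℂ) x :=
    fun x => (Real.hasDerivAt_sinh x).ofReal_comp
  have hmem : Real.pi / 2 ∈ Icc 0 (Real.pi / 2) := ⟨by positivity, le_rfl⟩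
  have e1 : sl 0 (-1) (1, 0) (Real.pi / 2) = _ :=
    isSl_unique (L := Real.pi / 2) (fun x _ => sl_deriv 0 (-1) (1,0) x)
    (Z := fun x => (((Real.cosh x : ℝ) : ℂ), ((Real.sinh x : ℝ) : ℂ))) (fun x _ => by
      simpa [matA_apply, qQ] using (hch x).prodMk (hsh x)) (by simp [sl_zero]) _ hmem
  have e2 : sl 0 (-1) (0, 1) (Real.pi / 2) = _ :=
    isSl_unique (L := Real.pi / 2) (fun x _ => sl_deriv 0 (-1) (0,1) x)
    (Z := fun x => (((Real.sinh x : ℝ) : ℂ), ((Real.cosh x : ℝ) : ℂ))) (fun x _ => by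
      simpa [matA_apply, qQ] using (hsh x).prodMk (hch x)) (by simp [sl_zero]) _ hmem
  unfold FF ea eb ec ed
  rw [e1, e2]
  simp only [normSq_ofReal, conj_ofReal, ← ofReal_mul, ofReal_re]
  have h1 := Real.one_le_cosh (Real.pi / 2)
  have h2 : 0 < Real.sinh (Real.pi / 2) := Real.sinh_pos_iff.2 (by positivity)
  nlinarith

end concrete

theorem stmt10 (c : ℝ) (hc : 0 < c) (lam₀ : ℝ)
    (h : ∃ t ∈ Set.Icc (0 : ℝ) 1, mathieuEV c t (lam₀ : ℂ)) :
    ∃ μ : ℝ, μ ≤ lam₀ ∧ mathieuEV c 0 (μ : ℂ) := by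
  obtain ⟨t, -, ht⟩ := h
  have hl := ev_nonneg ht
  have hF := FF_le ht
  have hcont := FF_cont c (lam₀ + 1)
  have hstart : 2 < FF c (-1) := by
    by_contra! hle
    have h1 : ContinuousOn (fun s : ℝ => FF s (-1)) (Icc 0 c) :=
      hcont.comp (f := fun s : ℝ => (s, (-1 : ℝ))) (by fun_prop)
        (fun s hs => ⟨⟨by linarith [hs.1], hs.2⟩, ⟨by linarith, by linarith⟩⟩)
    obtain ⟨s, -, hs⟩ := intermediate_value_Icc' hc.le h1 ⟨hle, FF_zero.le⟩
    have := ev_nonneg (ev_of_FF hs)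
    linarith
  have h2 : ContinuousOn (fun s : ℝ => FF c s) (Icc (-1) lam₀) :=
    hcont.comp (f := fun s : ℝ => (c, s)) (by fun_prop)
      (fun s hs => ⟨⟨by linarith, le_rfl⟩, ⟨by linarith [hs.1], by linarith [hs.2]⟩⟩)
  obtain ⟨s, hs, hs2⟩ := intermediate_value_Icc' (by linarith) h2 ⟨hF, hstart.le⟩
  exact ⟨s, hs.2, ev_of_FF hs2⟩
end

section
/- Let V ∈ ℝ with V ≠ 1/2 and V ≠ −1/2, and let λ ∈ ℂ. If y₁ and y₂ are nonzero twice continuously differentiable functions from [0,π] to ℂ, each satisfying −y''(x) + ((1+2V)e^{2ix} + (1−2V)e^{−2ix})·y(x) = λ·y(x) for all x ∈ [0,π] together with the periodic boundary conditions y(π) = y(0) and y'(π) = y'(0), then y₁ and y₂ are linearly dependent over ℂ. The same conclusion holds if instead both satisfy the antiperiodic boundary conditions y(π) = −y(0) and y'(π) = −y'(0). In other words, the geometric multiplicity of every periodic and every antiperiodic eigenvalue of the Schrödinger operator with the optical potential is 1. -/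
/-- `y` is a nonzero solution of `−y'' + q y = λ y` on `[0,π]` with the optical
potential `q(x) = (1+2V)e^{2ix} + (1−2V)e^{−2ix}`. -/
def opticalSol (V : ℝ) (lam : ℂ) (y : ℝ → ℂ) : Prop :=
  ContDiff ℝ 2 y ∧ (∃ x ∈ Set.Icc (0 : ℝ) Real.pi, y x ≠ 0) ∧
    ∀ x ∈ Set.Icc (0 : ℝ) Real.pi,
      -(deriv (deriv y) x) +
        ((1 + 2 * (V : ℂ)) * Complex.exp (2 * Complex.I * (x : ℂ)) +
          (1 - 2 * (V : ℂ)) * Complex.exp (-(2 * Complex.I * (x : ℂ)))) * y x = lam * y x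

open MeasureTheory Filter Topology

/-- Fourier-type coefficient. -/
noncomputable def opF (y : ℝ → ℂ) (m : ℤ) : ℂ :=
  ∫ x in (0 : ℝ)..Real.pi, y x * Complex.exp (-(Complex.I * m * (x : ℂ)))

lemma opF_int {y : ℝ → ℂ} (hy : Continuous y) (m : ℤ) :
    IntervalIntegrable (fun x : ℝ => y x * Complex.exp (-(Complex.I * m * (x : ℂ)))) volume
      0 Real.pi := by
  apply Continuous.intervalIntegrable
  fun_prop

lemma op_rec (V : ℝ) (lam : ℂ) (y : ℝ → ℂ) (h : opticalSol V lam y) (m : ℤ)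
    (hb : y Real.pi * Complex.exp (-(Complex.I * m * (Real.pi : ℂ))) = y 0)
    (hb' : deriv y Real.pi * Complex.exp (-(Complex.I * m * (Real.pi : ℂ))) = deriv y 0) :
    (1 + 2 * (V : ℂ)) * opF y (m - 2) + (1 - 2 * (V : ℂ)) * opF y (m + 2)
      = (lam - m ^ 2) * opF y m := by
  obtain ⟨hc, -, he⟩ := h
  have hy : Continuous y := hc.continuous
  have hd1 : Differentiable ℝ y := hc.differentiable (by norm_num)
  have hc' : ContDiff ℝ 1 (deriv y) := by
    have : ContDiff ℝ (1 + 1) y := by simpa [one_add_one_eq_two] using hc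
    exact (contDiff_succ_iff_deriv.1 this).2.2
  have hd2 : Differentiable ℝ (deriv y) := hc'.differentiable (by norm_num)
  have hcy'' : Continuous (deriv (deriv y)) := hc'.continuous_deriv (by norm_num)
  have hE : ∀ x : ℝ, HasDerivAt (fun x : ℝ => Complex.exp (-(Complex.I * m * (x : ℂ))))
      (Complex.exp (-(Complex.I * m * (x : ℂ))) * (-(Complex.I * m))) x := by
    intro x
    have h1 : HasDerivAt (fun x : ℝ => -(Complex.I * m * (x : ℂ))) (-(Complex.I * m)) x := by
      have h2 := ((Complex.ofRealCLM.hasDerivAt (x := x)).const_mul (Complex.I * m)).neg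
      refine HasDerivAt.congr_deriv h2 ?_
      simp
    exact h1.cexp
  have hG : ∀ x : ℝ, HasDerivAt (fun x : ℝ =>
      (deriv y x + Complex.I * m * y x) * Complex.exp (-(Complex.I * m * (x : ℂ))))
      ((deriv (deriv y) x + m ^ 2 * y x) * Complex.exp (-(Complex.I * m * (x : ℂ)))) x := by
    intro x
    have h1 := ((hd2 x).hasDerivAt.add ((hd1 x).hasDerivAt.const_mul (Complex.I * m))).mul (hE x)
    refine h1.congr_deriv ?_
    simp only [Pi.add_apply]
    linear_combination (-(m:ℂ)^2 * y x * Complex.exp (-(Complex.I * m * (x : ℂ)))) * Complex.I_sq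
  have hI : ∫ x in (0:ℝ)..Real.pi,
      (deriv (deriv y) x + m ^ 2 * y x) * Complex.exp (-(Complex.I * m * (x : ℂ))) = 0 := by
    rw [intervalIntegral.integral_eq_sub_of_hasDerivAt (fun x _ => hG x)
      (Continuous.intervalIntegrable (by fun_prop) _ _)]
    simp only [Complex.ofReal_zero, mul_zero, neg_zero, Complex.exp_zero]
    linear_combination hb' + Complex.I * m * hb
  have hJ : ∫ x in (0:ℝ)..Real.pi,
      (deriv (deriv y) x + m ^ 2 * y x) * Complex.exp (-(Complex.I * m * (x : ℂ))) =
      ∫ x in (0:ℝ)..Real.pi,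
      (((1 + 2 * (V : ℂ)) * (y x * Complex.exp (-(Complex.I * (m - 2 : ℤ) * (x : ℂ)))) +
       (1 - 2 * (V : ℂ)) * (y x * Complex.exp (-(Complex.I * (m + 2 : ℤ) * (x : ℂ))))) -
       (lam - m ^ 2) * (y x * Complex.exp (-(Complex.I * m * (x : ℂ))))) := by
    apply intervalIntegral.integral_congr
    intro x hx
    rw [Set.uIcc_of_le Real.pi_pos.le] at hx
    have h0 := he x hx
    have e1 : Complex.exp (-(Complex.I * (m - 2 : ℤ) * (x : ℂ))) =
      Complex.exp (2 * Complex.I * (x : ℂ)) * Complex.exp (-(Complex.I * m * (x : ℂ))) := by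
      rw [← Complex.exp_add]; congr 1; push_cast; ring
    have e2 : Complex.exp (-(Complex.I * (m + 2 : ℤ) * (x : ℂ))) =
      Complex.exp (-(2 * Complex.I * (x : ℂ))) * Complex.exp (-(Complex.I * m * (x : ℂ))) := by
      rw [← Complex.exp_add]; congr 1; push_cast; ring
    simp only [e1, e2]
    linear_combination (-Complex.exp (-(Complex.I * m * (x : ℂ)))) * h0
  rw [hJ, intervalIntegral.integral_sub
    (((opF_int hy _).const_mul _).add ((opF_int hy _).const_mul _)) ((opF_int hy _).const_mul _),
    intervalIntegral.integral_add ((opF_int hy _).const_mul _) ((opF_int hy _).const_mul _)] at hI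
  simp only [intervalIntegral.integral_const_mul] at hI
  exact sub_eq_zero.1 hI

lemma opF_hasSum {y : ℝ → ℂ} (hy : Continuous y) (s : ℤ) :
    HasSum (fun n : ℤ => ‖(1 / Real.pi) • opF y (2 * n + s)‖ ^ 2)
      (Real.pi⁻¹ • ∫ x in (0:ℝ)..Real.pi, ‖y x‖ ^ 2) := by
  have hf : Continuous (fun x : ℝ => y x * Complex.exp (-(Complex.I * s * (x : ℂ)))) := by fun_prop
  have hL : MemLp (fun x : ℝ => y x * Complex.exp (-(Complex.I * s * (x : ℂ)))) 2
      (volume.restrict (Set.Ioc 0 Real.pi)) :=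
    by
    rw [memLp_two_iff_integrable_sq_norm hf.aestronglyMeasurable]
    exact (Continuous.integrableOn_Icc (hf.norm.pow 2)).mono_set Set.Ioc_subset_Icc_self
  have h := hasSum_sq_fourierCoeffOn Real.pi_pos hL
  convert h using 1
  · funext n
    rw [fourierCoeffOn_eq_integral]
    congr 3
    · simp
    · unfold opF
      apply intervalIntegral.integral_congr
      intro x _
      simp only [fourier_coe_apply, smul_eq_mul, sub_zero]
      rw [mul_left_comm, ← Complex.exp_add]
      congr 2
      have : (Real.pi : ℂ) ≠ 0 := by exact_mod_cast Real.pi_ne_zero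
      push_cast
      field_simp
      ring
  · have : ∀ x : ℝ, ‖Complex.exp (-(Complex.I * s * (x : ℂ)))‖ = 1 := by
      intro x
      rw [Complex.norm_exp]; simp
    simp [this]

lemma opF_tendsto {y : ℝ → ℂ} (hy : Continuous y) (s : ℤ) :
    Tendsto (fun n : ℤ => opF y (2 * n + s)) cofinite (𝓝 0) := by
  have h := (opF_hasSum hy s).summable.tendsto_cofinite_zero
  have h2 := (h.sqrt).const_mul Real.pi
  rw [tendsto_zero_iff_norm_tendsto_zero]
  convert h2 using 2 with n
  · rw [Real.sqrt_sq (norm_nonneg _), norm_smul]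
    have := Real.pi_pos
    rw [Real.norm_of_nonneg (by positivity)]
    field_simp
  · simp

lemma opF_zero {y : ℝ → ℂ} (hy : Continuous y) (s : ℤ) (h : ∀ n : ℤ, opF y (2 * n + s) = 0) :
    ∀ x ∈ Set.Icc (0:ℝ) Real.pi, y x = 0 := by
  have h1 := opF_hasSum hy s
  simp only [h, smul_zero, norm_zero, ne_eq, OfNat.ofNat_ne_zero, not_false_eq_true, zero_pow] at h1
  have h2 := h1.unique hasSum_zero
  have h3 : ∫ x in (0:ℝ)..Real.pi, ‖y x‖ ^ 2 = 0 := by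
    have := Real.pi_ne_zero
    simpa [this] using h2
  intro x hx
  by_contra hne
  have := intervalIntegral.integral_pos Real.pi_pos (f := fun x => ‖y x‖ ^ 2)
    (by fun_prop) (fun _ _ => by positivity) ⟨x, hx, by positivity⟩
  linarith

lemma op_up (W : ℤ → ℂ) (hW : Tendsto W cofinite (𝓝 0))
    (h : ∀ n, ‖W n‖ ≤ ‖W (n + 1)‖) (m : ℤ) : W m = 0 := by
  have ht : Tendsto (fun k : ℕ => ‖W (m + k)‖) atTop (𝓝 0) := by
    have hi : Function.Injective (fun k : ℕ => m + (k : ℤ)) := fun a b hab => by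
      simpa using hab
    have := (hW.comp hi.tendsto_cofinite).norm
    rw [Nat.cofinite_eq_atTop] at this
    simpa using this
  have hm : Monotone (fun k : ℕ => ‖W (m + k)‖) := monotone_nat_of_le_succ (fun k => by
    have := h (m + k)
    push_cast
    rwa [← add_assoc])
  have := hm.ge_of_tendsto ht 0
  simpa using this

lemma op_W (a b : ℂ) (ha : a ≠ 0) (hb : b ≠ 0) (W : ℤ → ℂ) (hW : Tendsto W cofinite (𝓝 0))
    (h : ∀ n, b * W (n + 1) = a * W n) (m : ℤ) : W m = 0 := by
  have hn : ∀ n, ‖b‖ * ‖W (n + 1)‖ = ‖a‖ * ‖W n‖ := fun n => by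
    rw [← norm_mul, ← norm_mul, h]
  have ha' : 0 < ‖a‖ := norm_pos_iff.2 ha
  have hb' : 0 < ‖b‖ := norm_pos_iff.2 hb
  rcases le_total ‖b‖ ‖a‖ with hab | hab
  · apply op_up W hW
    intro n
    refine le_of_mul_le_mul_left ?_ hb'
    rw [hn]
    gcongr
  · have := op_up (fun n => W (-n)) (hW.comp neg_injective.tendsto_cofinite) (fun n => by
      refine le_of_mul_le_mul_left ?_ ha'
      have h1 := hn (-(n + 1))
      rw [← h1]
      rw [show -(n + 1) + 1 = -n by ring]
      gcongr) (-m)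
    simpa using this

lemma op_zero_rec (a b : ℂ) (ha : a ≠ 0) (hb : b ≠ 0) (u g : ℤ → ℂ)
    (h : ∀ n, a * u (n - 1) + b * u (n + 1) = g n * u n) (h0 : u 0 = 0) (h1 : u 1 = 0) :
    ∀ n, u n = 0 := by
  have : ∀ n, u n = 0 ∧ u (n + 1) = 0 := by
    intro n
    induction n using Int.induction_on with
    | zero => exact ⟨h0, by simpa using h1⟩
    | succ k ih =>
      refine ⟨ih.2, ?_⟩
      have := h (k + 1)
      rw [add_sub_cancel_right, ih.1, ih.2] at this
      simpa [hb] using this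
    | pred k ih =>
      have := h (-k)
      rw [ih.1, ih.2] at this
      refine ⟨by simpa [ha] using this, by simpa using ih.1⟩
  exact fun n => (this n).1

lemma op_main (V : ℝ) (hV : V ≠ 1 / 2) (hV' : V ≠ -(1 / 2)) (lam : ℂ)
    (y₁ y₂ : ℝ → ℂ) (h₁ : opticalSol V lam y₁) (h₂ : opticalSol V lam y₂) (s : ℤ)
    (hb : ∀ n : ℤ, ∀ w, (w = y₁ ∨ w = deriv y₁ ∨ w = y₂ ∨ w = deriv y₂) →
      w Real.pi * Complex.exp (-(Complex.I * (2 * n + s : ℤ) * (Real.pi : ℂ))) = w 0) :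
    ∃ a b : ℂ, (a ≠ 0 ∨ b ≠ 0) ∧
      ∀ x ∈ Set.Icc (0 : ℝ) Real.pi, a * y₁ x + b * y₂ x = 0 := by
  have hc1 := h₁.1.continuous
  have hc2 := h₂.1.continuous
  set A : ℂ := 1 + 2 * (V : ℂ) with hA
  set B : ℂ := 1 - 2 * (V : ℂ) with hB
  have hA0 : A ≠ 0 := by
    intro h0
    apply hV'
    rw [hA] at h0
    have : (1 + 2 * V : ℝ) = 0 := by exact_mod_cast h0
    linarith
  have hB0 : B ≠ 0 := by
    intro h0
    apply hV
    rw [hB] at h0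
    have : (1 - 2 * V : ℝ) = 0 := by exact_mod_cast h0
    linarith
  set c : ℤ → ℂ := fun n => opF y₁ (2 * n + s) with hc
  set d : ℤ → ℂ := fun n => opF y₂ (2 * n + s) with hd
  set g : ℤ → ℂ := fun n => lam - ((2 * n + s : ℤ) : ℂ) ^ 2 with hg
  have rc : ∀ n, A * c (n - 1) + B * c (n + 1) = g n * c n := fun n => by
    have := op_rec V lam y₁ h₁ (2 * n + s) (hb n _ (by simp)) (hb n _ (by simp))
    rw [show 2 * n + s - 2 = 2 * (n - 1) + s by ring,
      show 2 * n + s + 2 = 2 * (n + 1) + s by ring] at this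
    exact this
  have rd : ∀ n, A * d (n - 1) + B * d (n + 1) = g n * d n := fun n => by
    have := op_rec V lam y₂ h₂ (2 * n + s) (hb n _ (by simp)) (hb n _ (by simp))
    rw [show 2 * n + s - 2 = 2 * (n - 1) + s by ring,
      show 2 * n + s + 2 = 2 * (n + 1) + s by ring] at this
    exact this
  have tc : Tendsto c cofinite (𝓝 0) := opF_tendsto hc1 s
  have td : Tendsto d cofinite (𝓝 0) := opF_tendsto hc2 s
  have hi : Function.Injective (fun n : ℤ => n + 1) := add_left_injective 1
  have tW : Tendsto (fun n => c n * d (n + 1) - c (n + 1) * d n) cofinite (𝓝 0) := by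
    have := (tc.mul (td.comp hi.tendsto_cofinite)).sub ((tc.comp hi.tendsto_cofinite).mul td)
    simpa using this
  have hW := op_W A B hA0 hB0 _ tW (fun n => by
    have e1 := rc (n + 1)
    have e2 := rd (n + 1)
    rw [add_sub_cancel_right] at e1 e2
    linear_combination c (n + 1) * e2 - d (n + 1) * e1) 0
  simp only [zero_add] at hW
  obtain ⟨α, β, hne, z0, z1⟩ : ∃ α β : ℂ, (α ≠ 0 ∨ β ≠ 0) ∧ α * c 0 + β * d 0 = 0 ∧
      α * c 1 + β * d 1 = 0 := by
    by_cases k0 : c 0 = 0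
    · by_cases k1 : c 1 = 0
      · exact ⟨1, 0, by simp, by simp [k0], by simp [k1]⟩
      · exact ⟨d 1, -c 1, by simp [k1], by linear_combination hW, by ring⟩
    · exact ⟨d 0, -c 0, by simp [k0], by ring, by linear_combination -hW⟩
  refine ⟨α, β, hne, ?_⟩
  have hz := op_zero_rec A B hA0 hB0 (fun n => α * c n + β * d n) g (fun n => by
    linear_combination α * rc n + β * rd n) z0 z1
  refine opF_zero (y := fun x => α * y₁ x + β * y₂ x) (by fun_prop) s (fun n => ?_)
  rw [← hz n]
  simp only [hc, hd, opF]
  rw [← intervalIntegral.integral_const_mul, ← intervalIntegral.integral_const_mul,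
    ← intervalIntegral.integral_add ((opF_int hc1 _).const_mul _) ((opF_int hc2 _).const_mul _)]
  congr 1
  funext x
  ring

/-- The geometric multiplicity of every periodic and every antiperiodic eigenvalue
of the Schrödinger operator with the optical potential is 1. -/
theorem stmt13 (V : ℝ) (hV : V ≠ 1 / 2) (hV' : V ≠ -(1 / 2)) (lam : ℂ)
    (y₁ y₂ : ℝ → ℂ) (h₁ : opticalSol V lam y₁) (h₂ : opticalSol V lam y₂)
    (hbc : (y₁ Real.pi = y₁ 0 ∧ deriv y₁ Real.pi = deriv y₁ 0 ∧
            y₂ Real.pi = y₂ 0 ∧ deriv y₂ Real.pi = deriv y₂ 0) ∨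
           (y₁ Real.pi = -(y₁ 0) ∧ deriv y₁ Real.pi = -(deriv y₁ 0) ∧
            y₂ Real.pi = -(y₂ 0) ∧ deriv y₂ Real.pi = -(deriv y₂ 0))) :
    ∃ a b : ℂ, (a ≠ 0 ∨ b ≠ 0) ∧
      ∀ x ∈ Set.Icc (0 : ℝ) Real.pi, a * y₁ x + b * y₂ x = 0 := by
  have E0 : ∀ n : ℤ, Complex.exp (-(Complex.I * (2 * n + 0 : ℤ) * (Real.pi : ℂ))) = 1 := fun n => by
    rw [Complex.exp_eq_one_iff]
    exact ⟨-n, by push_cast; ring⟩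
  have E1 : ∀ n : ℤ, Complex.exp (-(Complex.I * (2 * n + 1 : ℤ) * (Real.pi : ℂ))) = -1 := fun n => by
    have h : -(Complex.I * (2 * n + 1 : ℤ) * (Real.pi : ℂ)) =
        -(Complex.I * (2 * (n + 1) + 0 : ℤ) * (Real.pi : ℂ)) + Real.pi * Complex.I := by
      push_cast; ring
    rw [h, Complex.exp_add, E0, Complex.exp_pi_mul_I, one_mul]
  rcases hbc with ⟨b1, b2, b3, b4⟩ | ⟨b1, b2, b3, b4⟩
  · refine op_main V hV hV' lam y₁ y₂ h₁ h₂ 0 (fun n w hw => ?_)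
    rw [E0]
    rcases hw with rfl | rfl | rfl | rfl <;> simp [*]
  · refine op_main V hV hV' lam y₁ y₂ h₁ h₂ 1 (fun n w hw => ?_)
    rw [E1]
    rcases hw with rfl | rfl | rfl | rfl <;> simp [*]
end

section
/- For each integer n ≥ 2 there exists c₀ > 0 such that for all c ∈ (0, c₀) the following holds: if λ ∈ ℝ is both a periodic eigenvalue and a Dirichlet eigenvalue of H(c) with |λ − (2n)²| ≤ 2c, and μ ∈ ℝ is both a periodic eigenvalue and a Neumann eigenvalue of H(c) with |μ − (2n)²| ≤ 2c, then λ < μ when n is even and μ < λ when n is odd. (Equivalently, for small c the periodic eigenvalues λ_{4k}(0,c) and λ_{4k+3}(0,c) are Dirichlet eigenvalues while λ_{4k+1}(0,c) and λ_{4k+2}(0,c) are Neumann eigenvalues.) -/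
/-- `lam` is a Dirichlet eigenvalue of the Mathieu-type operator `H(c)`. -/
def dirichletEV (c : ℝ) (lam : ℂ) : Prop :=
  ∃ y : ℝ → ℂ, ContDiff ℝ 2 y ∧ (∃ x ∈ Set.Icc (0 : ℝ) Real.pi, y x ≠ 0) ∧
    (∀ x ∈ Set.Icc (0 : ℝ) Real.pi,
      -(deriv (deriv y) x) + 2 * Complex.I * (c : ℂ) * Complex.cos (2 * (x : ℂ)) * y x
        = lam * y x) ∧
    y 0 = 0 ∧ y Real.pi = 0

/-- `lam` is a Neumann eigenvalue of the Mathieu-type operator `H(c)`. -/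
def neumannEV (c : ℝ) (lam : ℂ) : Prop :=
  ∃ y : ℝ → ℂ, ContDiff ℝ 2 y ∧ (∃ x ∈ Set.Icc (0 : ℝ) Real.pi, y x ≠ 0) ∧
    (∀ x ∈ Set.Icc (0 : ℝ) Real.pi,
      -(deriv (deriv y) x) + 2 * Complex.I * (c : ℂ) * Complex.cos (2 * (x : ℂ)) * y x
        = lam * y x) ∧
    deriv y 0 = 0 ∧ deriv y Real.pi = 0


lemma decay_ratio (u : ℕ → ℝ) (K ε : ℝ) (hK : ∀ k, |u k| ≤ K) (he : 0 < ε) (he' : ε ≤ 1/4)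
    (h : ∀ k, |u (k+1)| ≤ ε * (|u k| + |u (k+2)|)) (k : ℕ) : |u (k+1)| ≤ 2 * ε * |u k| := by
  by_contra! hc
  have key : ∀ m, 2 * ε * |u (k+m)| < |u (k+m+1)| ∧ 2 ^ m * |u (k+1)| ≤ |u (k+m+1)| := by
    intro m
    induction m with
    | zero => simpa using hc
    | succ m ih =>
      obtain ⟨h1, h2⟩ := ih
      have h3 := h (k+m)
      have e : k + (m+1) = k+m+1 := by ring
      rw [e]
      have h4 : |u (k+m+1)| < 2 * ε * |u (k+m+2)| := by nlinarith
      have h0 := abs_nonneg (u (k+m+2))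
      have h0' := abs_nonneg (u (k+m+1))
      have h5 : 2 * |u (k+m+1)| ≤ |u (k+m+1+1)| := by
        show 2 * |u (k+m+1)| ≤ |u (k+m+2)|
        nlinarith
      refine ⟨?_, ?_⟩
      · have : 0 < |u (k+m+2)| := by
          by_contra! hh
          nlinarith
        show 2 * ε * |u (k+m+1)| < |u (k+m+2)|
        nlinarith
      · rw [pow_succ]; linarith
  have hpos : 0 < |u (k+1)| := lt_of_le_of_lt (by positivity) hc
  obtain ⟨m, hm⟩ := pow_unbounded_of_one_lt (K / |u (k+1)|) (by norm_num : (1:ℝ) < 2)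
  rw [div_lt_iff₀ hpos] at hm
  linarith [(key m).2, hK (k+m+1)]

lemma gap_even (n j : ℕ) (hn : 2 ≤ n) (lam c : ℝ) (hc : c < 1)
    (h : |lam - (2 * (n : ℝ)) ^ 2| ≤ 2 * c) :
    (j < n → 10 ≤ lam - 4 * (j:ℝ)^2) ∧ (n < j → 10 ≤ 4 * (j:ℝ)^2 - lam) := by
  have hn' : (2:ℝ) ≤ n := by exact_mod_cast hn
  have hj : (0:ℝ) ≤ j := by positivity
  rw [abs_le] at h
  constructor
  · intro hjn
    have : (j:ℝ) + 1 ≤ n := by exact_mod_cast hjn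
    nlinarith
  · intro hjn
    have : (n:ℝ) + 1 ≤ j := by exact_mod_cast hjn
    nlinarith

/-- upper decay -/
lemma upper (n : ℕ) (hn : 2 ≤ n) (lam c : ℝ) (hc0 : 0 < c) (hc : c < 1)
    (hl : |lam - (2 * (n : ℝ)) ^ 2| ≤ 2 * c) (g : ℕ → ℝ) (K : ℝ) (hK : ∀ k, |g k| ≤ K)
    (hg : ∀ j : ℕ, (lam - 4 * ((j:ℝ)+1)^2) * g (j+1) = c * (g (j+2) - g j)) (k : ℕ) :
    |g (n+k+1)| ≤ 1/2 * |g (n+k)| := by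
  have := decay_ratio (fun k => g (n+k)) K (1/4) (fun k => hK _) (by norm_num) (by norm_num) ?_ k
  · norm_num at this ⊢; exact this
  intro k
  have h1 := (gap_even n (n+k+1) hn lam c hc hl).2 (by omega)
  have h2 := hg (n+k)
  push_cast at h1 h2
  show |g (n+k+1)| ≤ 1/4 * (|g (n+k)| + |g (n+k+2)|)
  set x := 4 * ((n:ℝ) + k + 1)^2 - lam with hx
  have h3 : x * |g (n+k+1)| = c * |g (n+k+2) - g (n+k)| := by
    rw [← abs_of_pos (by linarith : 0 < x), ← abs_mul]
    rw [show c * |g (n+k+2) - g (n+k)| = |c * (g (n+k+2) - g (n+k))| by rw [abs_mul, abs_of_pos hc0], ← h2, hx, ← abs_neg]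
    congr 1; ring
  have h4 := abs_sub (g (n+k+2)) (g (n+k))
  have := abs_nonneg (g (n+k+1))
  have := abs_nonneg (g (n+k+2) - g (n+k))
  nlinarith

lemma lower (n : ℕ) (hn : 2 ≤ n) (lam c : ℝ) (hc0 : 0 < c) (hc : c < 1)
    (hl : |lam - (2 * (n : ℝ)) ^ 2| ≤ 2 * c) (g : ℕ → ℝ)
    (hg : ∀ j : ℕ, (lam - 4 * ((j:ℝ)+1)^2) * g (j+1) = c * (g (j+2) - g j))
    (h0 : 0 ≤ g 0) (h1 : 0 < g 1) (h01 : 2 * g 0 ≤ g 1) (j : ℕ) (hj : j < n) :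
    0 ≤ g j ∧ 0 < g (j+1) ∧ 2 * g j ≤ g (j+1) := by
  induction j with
  | zero => exact ⟨h0, h1, h01⟩
  | succ j ih =>
    obtain ⟨a1, a2, a3⟩ := ih (by omega)
    have b1 := (gap_even n (j+1) hn lam c hc hl).1 (by omega)
    have b2 := hg j
    push_cast at b1
    have : 2 * g (j+1) ≤ g (j+2) := by
      have : c * (2 * g (j+1)) ≤ c * g (j+2) := by nlinarith
      exact le_of_mul_le_mul_left this hc0
    exact ⟨a2.le, by show 0 < g (j+2); linarith, this⟩

lemma lower_sum (p : ℕ → ℝ) (n : ℕ) (h0 : p 0 = 0)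
    (hp : ∀ j < n, 4 * p j ≤ p (j+1)) (hp0 : ∀ j ≤ n, 0 ≤ p j) (m : ℕ) (hm : m ≤ n) :
    |∑ j ∈ Finset.range m, (-1)^j * p j| ≤ p m / 3 := by
  induction m with
  | zero => simp [h0]
  | succ m ih =>
    rw [Finset.sum_range_succ]
    have h1 := ih (by omega)
    have h2 := abs_add_le (∑ j ∈ Finset.range m, (-1)^j * p j) ((-1)^m * p m)
    have h3 : |(-1)^m * p m| = p m := by
      rw [abs_mul, abs_pow]; simp [abs_of_nonneg (hp0 m (by omega))]
    linarith [hp m (by omega)]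

lemma upper_sum (p : ℕ → ℝ) (n : ℕ) 
    (hp : ∀ k, 4 * |p (n+k+1)| ≤ |p (n+k)|) (m : ℕ) :
    |∑ j ∈ Finset.range m, (-1)^(n+1+j) * p (n+1+j)| + |p (n+m)|/3 ≤ |p n| / 3 := by
  induction m with
  | zero => simp
  | succ m ih =>
    rw [Finset.sum_range_succ]
    have h2 := abs_add_le (∑ j ∈ Finset.range m, (-1)^(n+1+j) * p (n+1+j)) ((-1)^(n+1+m) * p (n+1+m))
    have h3 : |(-1)^(n+1+m) * p (n+1+m)| = |p (n+m+1)| := by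
      rw [abs_mul, abs_pow]; simp [show n+1+m = n+m+1 by ring]
    have := hp m
    show _ + |p (n+m+1)|/3 ≤ _
    linarith

lemma core_pos (n : ℕ) (hn : 2 ≤ n) (lam mu c : ℝ) (hc0 : 0 < c) (hc : c < 1)
    (hl : |lam - (2 * (n : ℝ)) ^ 2| ≤ 2 * c) (hm : |mu - (2 * (n : ℝ)) ^ 2| ≤ 2 * c)
    (g h : ℕ → ℝ) (K L : ℝ) (hK : ∀ k, |g k| ≤ K) (hL : ∀ k, |h k| ≤ L)
    (hg : ∀ j : ℕ, (lam - 4 * ((j:ℝ)+1)^2) * g (j+1) = c * (g (j+2) - g j))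
    (hh : ∀ j : ℕ, (mu - 4 * ((j:ℝ)+1)^2) * h (j+1) = c * (h (j+2) - h j))
    (g0 : g 0 = 0) (h0 : mu * h 0 = 2 * c * h 1) (g1 : 0 < g 1) (hp0 : 0 < h 0) :
    0 < (-1)^n * (mu - lam) := by
  have hmu := (gap_even n 0 hn mu c hc hm).1 (by omega)
  simp at hmu
  have h01 : 2 * h 0 ≤ h 1 := by
    have : (2*c) * (2 * h 0) ≤ (2*c) * h 1 := by nlinarith
    exact le_of_mul_le_mul_left this (by linarith)
  have lg := lower n hn lam c hc0 hc hl g hg g0.ge g1 (by linarith)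
  have lh := lower n hn mu c hc0 hc hm h hh hp0.le (by linarith) h01
  have ug := upper n hn lam c hc0 hc hl g K hK hg
  have uh := upper n hn mu c hc0 hc hm h L hL hh
  set p : ℕ → ℝ := fun j => g j * h j with hpdef
  have hpl : ∀ j < n, 4 * p j ≤ p (j+1) := by
    intro j hj
    obtain ⟨a1, a2, a3⟩ := lg j hj
    obtain ⟨b1, b2, b3⟩ := lh j hj
    have := mul_le_mul a3 b3 (by linarith) a2.le
    simp only [hpdef]; linarith
  have hgn : ∀ j ≤ n, 0 ≤ g j ∧ 0 ≤ h j := by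
    intro j hj
    rcases j with _ | j
    · exact ⟨g0.ge, hp0.le⟩
    · exact ⟨(lg j (by omega)).2.1.le, (lh j (by omega)).2.1.le⟩
  have hpn : ∀ j ≤ n, 0 ≤ p j := fun j hj => mul_nonneg (hgn j hj).1 (hgn j hj).2
  have hpu : ∀ k, 4 * |p (n+k+1)| ≤ |p (n+k)| := by
    intro k
    have := mul_le_mul (ug k) (uh k) (abs_nonneg _) (by positivity)
    simp only [hpdef, abs_mul]; linarith
  have hpp : 0 < p n := by
    obtain ⟨m, rfl⟩ : ∃ m, n = m+1 := ⟨n-1, by omega⟩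
    exact mul_pos (lg m (by omega)).2.1 (lh m (by omega)).2.1
  have sl := lower_sum p n (by simp [hpdef, g0]) hpl hpn n le_rfl
  have su := upper_sum p n hpu
  have W : ∀ N, (mu - lam) * ∑ j ∈ Finset.range (N+1), (-1)^j * p j
      = c * (g 1 * h 0 + (-1)^N * (h (N+1) * g N - g (N+1) * h N)) := by
    intro N
    induction N with
    | zero => simp [hpdef, g0]
    | succ N ih =>
      rw [Finset.sum_range_succ, mul_add, ih]
      have e1 := hg N
      have e2 := hh N
      simp only [hpdef, pow_succ]
      linear_combination (-1)^N * h (N+1) * e1 - (-1)^N * g (N+1) * e2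
  have gz : ∀ k, |g (n+k)| ≤ (1/2)^k * |g n| := by
    intro k
    induction k with
    | zero => simp
    | succ k ih =>
      have := ug k
      rw [pow_succ, ← add_assoc]; linarith
  have hgn0 : 0 ≤ K := (abs_nonneg _).trans (hK 0)
  have hL0 : 0 ≤ L := (abs_nonneg _).trans (hL 0)
  obtain ⟨m, hm'⟩ : ∃ m : ℕ, (1/2:ℝ)^m * (2 * K * L) < g 1 * h 0 := by
    have hpos : 0 < g 1 * h 0 := mul_pos g1 hp0
    obtain ⟨m, hm⟩ := exists_pow_lt_of_lt_one (show 0 < g 1 * h 0 / (2*K*L+1) by positivity) (by norm_num : (1/2:ℝ) < 1)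
    refine ⟨m, ?_⟩
    rw [lt_div_iff₀ (by positivity)] at hm
    have : (0:ℝ) < (1/2)^m := by positivity
    linarith
  have hW := W (n+m)
  have hV : |(-1)^(n+m) * (h (n+m+1) * g (n+m) - g (n+m+1) * h (n+m))| < g 1 * h 0 := by
    rw [abs_mul, abs_pow]
    simp only [abs_neg, abs_one, one_pow, one_mul]
    have a1 := gz m
    have a2 := ug m
    have a3 : |g (n+m)| ≤ (1/2)^m * K := a1.trans (by gcongr; exact hK n)
    have a4 : |g (n+m+1)| ≤ (1/2)^m * K := by linarith [abs_nonneg (g (n+m))]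
    calc _ ≤ |h (n+m+1) * g (n+m)| + |g (n+m+1) * h (n+m)| := abs_sub _ _
      _ = |h (n+m+1)| * |g (n+m)| + |g (n+m+1)| * |h (n+m)| := by rw [abs_mul, abs_mul]
      _ ≤ L * ((1/2)^m * K) + ((1/2)^m * K) * L := by
        gcongr
        · exact hL _
        · exact hL _
      _ < _ := by linarith
  have hS : 0 < (mu - lam) * ∑ j ∈ Finset.range (n+m+1), (-1)^j * p j := by
    rw [hW]; apply mul_pos hc0; linarith [(abs_lt.1 hV).1]
  have e : n+m+1 = n+1+m := by ring
  rw [e, Finset.sum_range_add, Finset.sum_range_succ] at hS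
  have su' := su m
  set A := ∑ j ∈ Finset.range n, (-1)^j * p j
  set B := ∑ j ∈ Finset.range m, (-1)^(n+1+j) * p (n+1+j)
  have := abs_nonneg (p (n+m))
  rw [abs_of_pos hpp] at su'
  have sB : |B| ≤ p n / 3 := by linarith
  have := abs_le.1 sl
  have := abs_le.1 sB
  rcases neg_one_pow_eq_or ℝ n with hs | hs <;> rw [hs] at hS ⊢ <;> nlinarith

lemma core (n : ℕ) (hn : 2 ≤ n) (lam mu c : ℝ) (hc0 : 0 < c) (hc : c < 1)
    (hl : |lam - (2 * (n : ℝ)) ^ 2| ≤ 2 * c) (hm : |mu - (2 * (n : ℝ)) ^ 2| ≤ 2 * c)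
    (g h : ℕ → ℝ) (K L : ℝ) (hK : ∀ k, |g k| ≤ K) (hL : ∀ k, |h k| ≤ L)
    (hg : ∀ j : ℕ, (lam - 4 * ((j:ℝ)+1)^2) * g (j+1) = c * (g (j+2) - g j))
    (hh : ∀ j : ℕ, (mu - 4 * ((j:ℝ)+1)^2) * h (j+1) = c * (h (j+2) - h j))
    (g0 : g 0 = 0) (h0 : mu * h 0 = 2 * c * h 1) (gne : ∃ j, g j ≠ 0) (hne : ∃ j, h j ≠ 0) :
    0 < (-1)^n * (mu - lam) := by
  have zero : ∀ (l : ℝ) (u : ℕ → ℝ), (∀ j : ℕ, (l - 4 * ((j:ℝ)+1)^2) * u (j+1) = c * (u (j+2) - u j)) →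
      u 0 = 0 → u 1 = 0 → ∀ j, u j = 0 ∧ u (j+1) = 0 := by
    intro l u hu u0 u1 j
    induction j with
    | zero => exact ⟨u0, u1⟩
    | succ j ih =>
      refine ⟨ih.2, ?_⟩
      have := hu j
      rw [ih.1, ih.2] at this
      simp [hc0.ne'] at this
      exact this
  have g1 : g 1 ≠ 0 := by
    intro h1
    obtain ⟨j, hj⟩ := gne
    exact hj (zero lam g hg g0 h1 j).1
  have h00 : h 0 ≠ 0 := by
    intro h1
    obtain ⟨j, hj⟩ := hne
    rw [h1] at h0
    simp [hc0.ne'] at h0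
    exact hj (zero mu h hh h1 h0 j).1
  have scale : ∀ a b : ℝ, 0 < a * g 1 → 0 < b * h 0 → 0 < (-1)^n * (mu - lam) := by
    intro a b ha hb
    refine core_pos n hn lam mu c hc0 hc hl hm (fun j => a * g j) (fun j => b * h j) (|a| * K) (|b| * L) ?_ ?_ ?_ ?_ ?_ ?_ ha hb
    · intro k; rw [abs_mul]; gcongr; exact hK k
    · intro k; rw [abs_mul]; gcongr; exact hL k
    · intro j; linear_combination a * hg j
    · intro j; linear_combination b * hh j
    · simp [g0]
    · linear_combination b * h0
  exact scale (g 1) (h 0) (mul_self_pos.2 g1) (mul_self_pos.2 h00)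

/-- completeness -/
lemma complete_real (f : ℝ → ℝ) (hf : Continuous f)
    (h : ∀ k : ℕ, ∫ x in (0:ℝ)..Real.pi, f x * Real.cos x ^ k = 0) :
    ∀ x ∈ Set.Icc (0:ℝ) Real.pi, f x = 0 := by
  have hpoly : ∀ p : Polynomial ℝ, ∫ x in (0:ℝ)..Real.pi, f x * p.eval (Real.cos x) = 0 := by
    intro p
    simp only [Polynomial.eval_eq_sum_range, Finset.mul_sum]
    rw [intervalIntegral.integral_finsetSum]
    · apply Finset.sum_eq_zero
      intro i _
      have : ∀ x, f x * (p.coeff i * Real.cos x ^ i) = p.coeff i * (f x * Real.cos x ^ i) := by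
        intro x; ring
      simp only [this]
      rw [intervalIntegral.integral_const_mul, h, mul_zero]
    · intro i _
      apply Continuous.intervalIntegrable; fun_prop
  have hle : ∀ ε > 0, ∫ x in (0:ℝ)..Real.pi, f x * f x ≤ ε * ∫ x in (0:ℝ)..Real.pi, |f x| := by
    intro ε he
    obtain ⟨p, hp⟩ := exists_polynomial_near_of_continuousOn (-1) 1 (fun t => f (Real.arccos t))
      (by fun_prop) ε he
    have e : ∫ x in (0:ℝ)..Real.pi, f x * f x = ∫ x in (0:ℝ)..Real.pi, f x * (f x - p.eval (Real.cos x)) := by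
      simp only [mul_sub]
      rw [intervalIntegral.integral_sub, hpoly, sub_zero]
      · apply Continuous.intervalIntegrable; fun_prop
      · apply Continuous.intervalIntegrable; fun_prop
    rw [e, ← intervalIntegral.integral_const_mul]
    apply intervalIntegral.integral_mono_on Real.pi_pos.le
    · apply Continuous.intervalIntegrable; fun_prop
    · apply Continuous.intervalIntegrable; fun_prop
    · intro x hx
      have := hp (Real.cos x) ⟨Real.neg_one_le_cos x, Real.cos_le_one x⟩
      rw [Real.arccos_cos hx.1 hx.2] at this
      rw [abs_sub_comm] at this
      calc _ ≤ |f x * (f x - p.eval (Real.cos x))| := le_abs_self _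
        _ = |f x - p.eval (Real.cos x)| * |f x| := by rw [abs_mul, mul_comm]
        _ ≤ _ := by gcongr
  have hI : 0 ≤ ∫ x in (0:ℝ)..Real.pi, |f x| :=
    intervalIntegral.integral_nonneg Real.pi_pos.le (fun x _ => abs_nonneg _)
  have hz : ∫ x in (0:ℝ)..Real.pi, f x * f x ≤ 0 := by
    apply le_of_forall_pos_le_add
    intro δ hδ
    have := hle (δ / ((∫ x in (0:ℝ)..Real.pi, |f x|) + 1)) (by positivity)
    refine this.trans ?_
    rw [zero_add, div_mul_eq_mul_div, div_le_iff₀ (by positivity)]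
    nlinarith
  intro x hx
  by_contra hne
  have := intervalIntegral.integral_pos Real.pi_pos (f := fun x => f x * f x) (by fun_prop)
    (fun x _ => mul_self_nonneg _) ⟨x, hx, mul_self_pos.2 hne⟩
  linarith

lemma complete_complex (f : ℝ → ℂ) (hf : Continuous f)
    (h : ∀ k : ℕ, ∫ x in (0:ℝ)..Real.pi, f x * (Real.cos x : ℂ) ^ k = 0) :
    ∀ x ∈ Set.Icc (0:ℝ) Real.pi, f x = 0 := by
  intro x hx
  have hint : ∀ k : ℕ, IntervalIntegrable (fun x => f x * (Real.cos x : ℂ) ^ k) MeasureTheory.volume 0 Real.pi := by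
    intro k
    apply Continuous.intervalIntegrable; fun_prop
  apply Complex.ext
  · refine complete_real (fun x => (f x).re) (by fun_prop) ?_ x hx
    intro k
    have := Complex.reCLM.intervalIntegral_comp_comm (hint k)
    rw [h k] at this
    simpa [← Complex.ofReal_pow, -Complex.ofReal_cos] using this
  · refine complete_real (fun x => (f x).im) (by fun_prop) ?_ x hx
    intro k
    have := Complex.imCLM.intervalIntegral_comp_comm (hint k)
    rw [h k] at this
    simpa [← Complex.ofReal_pow, -Complex.ofReal_cos] using this

lemma odd_zero (n : ℕ) (hn : 2 ≤ n) (lam c : ℝ) (hc0 : 0 < c) (hc : c < 1)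
    (hl : |lam - (2 * (n : ℝ)) ^ 2| ≤ 2 * c) (S : ℤ → ℂ) (K : ℝ) (hK : ∀ k, ‖S k‖ ≤ K)
    (hS : ∀ k : ℤ, ((lam : ℂ) - (k:ℂ)^2) * S k = Complex.I * c * (S (k+2) + S (k-2))) :
    ∀ k : ℤ, S (2*k+1) = 0 := by
  have gap : ∀ k : ℤ, 4 ≤ |lam - (2*(k:ℝ)+1)^2| := by
    intro k
    have hn' : (2:ℝ) ≤ n := by exact_mod_cast hn
    have h1 : 7 ≤ |(2*(n:ℝ))^2 - (2*(k:ℝ)+1)^2| := by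
      have : (7:ℤ) ≤ |(2*(n:ℤ))^2 - (2*k+1)^2| := by
        have hn2 : (2:ℤ) ≤ n := by exact_mod_cast hn
        rw [le_abs]
        rcases le_or_gt (|2*k+1|) (2*n) with h | h
        · left
          have h2 : |2*k+1| ≤ 2*n - 1 := by
            rcases abs_cases (2*k+1) with ⟨e, _⟩ | ⟨e, _⟩ <;> omega
          rw [← sq_abs (2*k+1)]
          nlinarith [abs_nonneg (2*k+1)]
        · right
          have h2 : 2*(n:ℤ) + 1 ≤ |2*k+1| := by omega
          rw [← sq_abs (2*k+1)]
          nlinarith [abs_nonneg (2*k+1)]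
      exact_mod_cast this
    have h2 := abs_sub_abs_le_abs_sub ((2*(n:ℝ))^2 - (2*(k:ℝ)+1)^2) ((2*(n:ℝ))^2 - lam)
    rw [abs_sub_comm] at hl
    have e : (2*(n:ℝ))^2 - (2*(k:ℝ)+1)^2 - ((2*(n:ℝ))^2 - lam) = lam - (2*(k:ℝ)+1)^2 := by ring
    rw [e] at h2
    linarith
  have key : ∀ m : ℕ, ∀ k : ℤ, ‖S (2*k+1)‖ ≤ (1/2)^m * K := by
    intro m
    induction m with
    | zero => intro k; simpa using hK _
    | succ m ih =>
      intro k
      have h1 := ih (k+1)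
      have h2 := ih (k-1)
      have h3 := congrArg norm (hS (2*k+1))
      rw [norm_mul, norm_mul, norm_mul] at h3
      have e : (lam:ℂ) - ((2*k+1 : ℤ):ℂ)^2 = ((lam - (2*(k:ℝ)+1)^2 : ℝ) : ℂ) := by push_cast; ring
      rw [e, Complex.norm_real, Complex.norm_real, Complex.norm_I, one_mul, Real.norm_eq_abs, Real.norm_eq_abs,
        abs_of_pos hc0, show 2*k+1+2 = 2*(k+1)+1 by ring, show 2*k+1-2 = 2*(k-1)+1 by ring] at h3
      have h4 := norm_add_le (S (2*(k+1)+1)) (S (2*(k-1)+1))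
      have h5 := gap k
      have := norm_nonneg (S (2*k+1))
      have := norm_nonneg (S (2*(k+1)+1) + S (2*(k-1)+1))
      rw [pow_succ]
      nlinarith
  intro k
  have hlim : Filter.Tendsto (fun m : ℕ => (1/2:ℝ)^m * K) Filter.atTop (nhds (0 * K)) :=
    (tendsto_pow_atTop_nhds_zero_of_lt_one (by norm_num) (by norm_num)).mul_const K
  have := ge_of_tendsto' hlim (fun m => key m k)
  rw [zero_mul] at this
  exact norm_le_zero_iff.1 this

lemma get_real (n : ℕ) (hn : 2 ≤ n) (lam c : ℝ) (hc0 : 0 < c) (hc : c < 1)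
    (hl : |lam - (2 * (n : ℝ)) ^ 2| ≤ 2 * c) (S : ℤ → ℂ) (K : ℝ) (hK : ∀ k, ‖S k‖ ≤ K)
    (hS : ∀ k : ℤ, ((lam : ℂ) - (k:ℂ)^2) * S k = Complex.I * c * (S (k+2) + S (k-2)))
    (hsym : ∀ k, ‖S (-k)‖ = ‖S k‖) (hne : ∃ k, S k ≠ 0) :
    ∃ g : ℕ → ℝ, (∀ k, |g k| ≤ K) ∧
      (∀ j : ℕ, (lam - 4 * ((j:ℝ)+1)^2) * g (j+1) = c * (g (j+2) - g j)) ∧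
      (∃ j, g j ≠ 0) ∧ (S 0 = 0 → g 0 = 0) ∧ (S (-2) = S 2 → lam * g 0 = 2 * c * g 1) := by
  have hodd := odd_zero n hn lam c hc0 hc hl S K hK hS
  obtain ⟨j, hj⟩ : ∃ j : ℕ, S (2*j) ≠ 0 := by
    obtain ⟨k, hk⟩ := hne
    rcases Int.even_or_odd' k with ⟨m, rfl | rfl⟩
    · refine ⟨m.natAbs, ?_⟩
      rcases Int.natAbs_eq m with h | h
      · rwa [← h]
      · rw [← norm_ne_zero_iff, ← hsym, norm_ne_zero_iff]
        rwa [h, mul_neg] at hk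
    · exact absurd (hodd m) hk
  set G : ℕ → ℂ := fun j => Complex.I^j * S (2*j) with hG
  have GK : ∀ k, ‖G k‖ ≤ K := by
    intro k; simp [hG, norm_pow]; exact hK _
  have Grec : ∀ j : ℕ, ((lam - 4 * ((j:ℝ)+1)^2 : ℝ) : ℂ) * G (j+1) = (c:ℂ) * (G (j+2) - G j) := by
    intro j
    have := hS (2*(j+1))
    simp only [hG]
    push_cast at this ⊢
    rw [show (2*((j:ℤ)+1)+2) = 2*((j:ℤ)+2) by ring, show (2*((j:ℤ)+1)-2) = 2*(j:ℤ) by ring] at this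
    have hI := Complex.I_sq
    rw [pow_add, pow_add, pow_one, hI]
    linear_combination Complex.I^j * Complex.I * this + Complex.I^j * c * (S (2*(j+2)) + S (2*j)) * hI
  have G0 : S (-2) = S 2 → ((lam:ℝ):ℂ) * G 0 = ((2*c:ℝ):ℂ) * G 1 := by
    intro h
    have := hS 0
    simp only [zero_add, zero_sub, h] at this
    simp [hG]
    simp at this
    linear_combination this
  have hGj : G j ≠ 0 := by simp [hG, hj]
  have hri : (G j).re ≠ 0 ∨ (G j).im ≠ 0 := by
    by_contra! hh
    exact hGj (Complex.ext hh.1 hh.2)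
  rcases hri with h | h
  · refine ⟨fun j => (G j).re, fun k => (Complex.abs_re_le_norm _).trans (GK k), ?_, ⟨j, h⟩, ?_, ?_⟩
    · intro j
      have := congrArg Complex.re (Grec j)
      rwa [Complex.re_ofReal_mul, Complex.re_ofReal_mul, Complex.sub_re] at this
    · intro h; simp [hG, h]
    · intro h
      have := congrArg Complex.re (G0 h)
      rwa [Complex.re_ofReal_mul, Complex.re_ofReal_mul] at this
  · refine ⟨fun j => (G j).im, fun k => (Complex.abs_im_le_norm _).trans (GK k), ?_, ⟨j, h⟩, ?_, ?_⟩
    · intro j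
      have := congrArg Complex.im (Grec j)
      rwa [Complex.im_ofReal_mul, Complex.im_ofReal_mul, Complex.sub_im] at this
    · intro h; simp [hG, h]
    · intro h
      have := congrArg Complex.im (G0 h)
      rwa [Complex.im_ofReal_mul, Complex.im_ofReal_mul] at this

/-- if all coefficients against a cosine-stable family vanish then so does the product -/
lemma coeff_zero (y : ℝ → ℂ) (hy : Continuous y) (e : ℤ → ℝ → ℂ) (he : ∀ k, Continuous (e k))
    (hcos : ∀ k x, 2 * (Real.cos x : ℂ) * e k x = e (k+1) x + e (k-1) x)
    (h : ∀ k, ∫ x in (0:ℝ)..Real.pi, y x * e k x = 0) (k : ℤ) :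
    ∀ x ∈ Set.Icc (0:ℝ) Real.pi, y x * e k x = 0 := by
  apply complete_complex
  · have := he k; fun_prop
  · intro m
    induction m generalizing k with
    | zero => simpa using h k
    | succ m ih =>
      have h1 := ih (k+1)
      have h2 := ih (k-1)
      have c1 := he (k+1)
      have c2 := he (k-1)
      have : ∀ x, y x * e k x * (Real.cos x : ℂ)^(m+1)
          = (1/2) * (y x * e (k+1) x * (Real.cos x : ℂ)^m + y x * e (k-1) x * (Real.cos x : ℂ)^m) := by
        intro x
        rw [pow_succ]
        linear_combination (1/2) * y x * (Real.cos x : ℂ)^m * hcos k x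
      simp only [this]
      rw [intervalIntegral.integral_const_mul, intervalIntegral.integral_add, h1, h2]
      · simp
      · apply Continuous.intervalIntegrable; fun_prop
      · apply Continuous.intervalIntegrable; fun_prop

lemma coeff_rec (y : ℝ → ℂ) (hy : ContDiff ℝ 2 y) (c lam : ℝ)
    (hode : ∀ x ∈ Set.Icc (0 : ℝ) Real.pi,
      -(deriv (deriv y) x) + 2 * Complex.I * (c : ℂ) * Complex.cos (2 * (x : ℂ)) * y x
        = lam * y x)
    (e : ℤ → ℝ → ℂ) (e' : ℝ → ℂ) (k : ℤ) (he : ∀ k, Continuous (e k))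
    (hcos : ∀ k x, 2 * (Real.cos x : ℂ) * e k x = e (k+1) x + e (k-1) x)
    (h1 : ∀ x, HasDerivAt (e k) (e' x) x) (h2 : ∀ x, HasDerivAt e' (-(k:ℂ)^2 * e k x) x)
    (b0 : deriv y 0 * e k 0 - y 0 * e' 0 = 0)
    (bpi : deriv y Real.pi * e k Real.pi - y Real.pi * e' Real.pi = 0) :
    ((lam : ℂ) - (k:ℂ)^2) * (∫ x in (0:ℝ)..Real.pi, y x * e k x)
      = Complex.I * c * ((∫ x in (0:ℝ)..Real.pi, y x * e (k+2) x) + ∫ x in (0:ℝ)..Real.pi, y x * e (k-2) x) := by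
  have hd1 : ∀ x, HasDerivAt y (deriv y x) x := fun x =>
    (hy.differentiable (by norm_num) x).hasDerivAt
  have hy1 : ContDiff ℝ 1 (deriv y) := by
    have : ContDiff ℝ (1+1) y := by norm_num; exact hy
    exact (contDiff_succ_iff_deriv.1 this).2.2
  have hd2 : ∀ x, HasDerivAt (deriv y) (deriv (deriv y) x) x := fun x =>
    (hy1.differentiable (by norm_num) x).hasDerivAt
  have hcd : Continuous (deriv (deriv y)) := hy1.continuous_deriv le_rfl
  have hyc := hy.continuous
  have hek := he k
  have ek1 := he (k+2)
  have ek2 := he (k-2)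
  have hder : ∀ x, HasDerivAt (fun x => deriv y x * e k x - y x * e' x)
      (deriv (deriv y) x * e k x + (k:ℂ)^2 * (y x * e k x)) x := by
    intro x
    have := ((hd2 x).mul (h1 x)).sub ((hd1 x).mul (h2 x))
    refine this.congr_deriv ?_
    ring
  have hI := intervalIntegral.integral_eq_sub_of_hasDerivAt (a := 0) (b := Real.pi) (fun x _ => hder x)
    (by apply Continuous.intervalIntegrable; fun_prop)
  rw [b0, bpi, sub_zero] at hI
  have hE : ∫ x in (0:ℝ)..Real.pi, (deriv (deriv y) x * e k x + (k:ℂ)^2 * (y x * e k x))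
      = ∫ x in (0:ℝ)..Real.pi, (Complex.I * c * (y x * e (k+2) x + y x * e (k-2) x)
        - (lam - (k:ℂ)^2) * (y x * e k x)) := by
    apply intervalIntegral.integral_congr
    intro x hx
    rw [Set.uIcc_of_le Real.pi_pos.le] at hx
    have := hode x hx
    have a0 := hcos k x
    have a1 := hcos (k+1) x
    have a2 := hcos (k-1) x
    rw [show k+1+1 = k+2 by ring, show k+1-1 = k by ring] at a1
    rw [show k-1+1 = k by ring, show k-1-1 = k-2 by ring] at a2
    rw [Complex.cos_two_mul] at this
    push_cast at a0 a1 a2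
    simp only
    linear_combination (-e k x) * this + Complex.I * c * y x * (2 * Complex.cos x * a0 + a1 + a2)
  rw [hE, intervalIntegral.integral_sub, intervalIntegral.integral_const_mul,
    intervalIntegral.integral_const_mul, intervalIntegral.integral_add] at hI
  · linear_combination -hI
  all_goals apply Continuous.intervalIntegrable; fun_prop

lemma coeff_bound (y : ℝ → ℂ) (hy : Continuous y) (e : ℤ → ℝ → ℂ) (he : ∀ k, Continuous (e k))
    (hb : ∀ k x, ‖e k x‖ ≤ 1) (k : ℤ) :
    ‖∫ x in (0:ℝ)..Real.pi, y x * e k x‖ ≤ ∫ x in (0:ℝ)..Real.pi, ‖y x‖ := by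
  refine (intervalIntegral.norm_integral_le_integral_norm Real.pi_pos.le).trans ?_
  have := he k
  apply intervalIntegral.integral_mono_on Real.pi_pos.le
  · apply Continuous.intervalIntegrable; fun_prop
  · apply Continuous.intervalIntegrable; fun_prop
  · intro x _
    rw [norm_mul]
    nlinarith [hb k x, norm_nonneg (y x)]

lemma hasDeriv_sin (k : ℤ) (x : ℝ) : HasDerivAt (fun x : ℝ => Complex.sin (k * x))
    (k * Complex.cos (k * x)) x := by
  have h0 : HasDerivAt (fun z : ℂ => (k:ℂ) * z) (k:ℂ) (x:ℂ) := by
    simpa using (hasDerivAt_id (x:ℂ)).const_mul (k:ℂ)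
  have := h0.csin.comp_ofReal
  rwa [mul_comm] at this

lemma hasDeriv_cos (k : ℤ) (x : ℝ) : HasDerivAt (fun x : ℝ => Complex.cos (k * x))
    (-(k * Complex.sin (k * x))) x := by
  have h0 : HasDerivAt (fun z : ℂ => (k:ℂ) * z) (k:ℂ) (x:ℂ) := by
    simpa using (hasDerivAt_id (x:ℂ)).const_mul (k:ℂ)
  have := h0.ccos.comp_ofReal
  convert this using 1
  ring

lemma dirichlet_seq (n : ℕ) (hn : 2 ≤ n) (lam c : ℝ) (hc0 : 0 < c) (hc : c < 1)
    (hl : |lam - (2 * (n : ℝ)) ^ 2| ≤ 2 * c) (hd : dirichletEV c (lam : ℂ)) :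
    ∃ (g : ℕ → ℝ) (K : ℝ), (∀ k, |g k| ≤ K) ∧
      (∀ j : ℕ, (lam - 4 * ((j:ℝ)+1)^2) * g (j+1) = c * (g (j+2) - g j)) ∧
      (∃ j, g j ≠ 0) ∧ g 0 = 0 := by
  obtain ⟨y, hy, hne, hode, y0, ypi⟩ := hd
  set e : ℤ → ℝ → ℂ := fun k x => Complex.sin (k * x) with hedef
  have he : ∀ k, Continuous (e k) := by intro k; simp only [hedef]; fun_prop
  have hcos : ∀ k x, 2 * (Real.cos x : ℂ) * e k x = e (k+1) x + e (k-1) x := by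
    intro k x
    simp only [hedef]
    push_cast
    rw [add_mul, sub_mul, one_mul, Complex.sin_add, Complex.sin_sub]
    ring
  have hb : ∀ k x, ‖e k x‖ ≤ 1 := by
    intro k x
    simp only [hedef]
    rw [show (k:ℂ) * (x:ℂ) = ((k * x : ℝ) : ℂ) by push_cast; rfl, ← Complex.ofReal_sin, Complex.norm_real]
    exact Real.abs_sin_le_one _
  have main := get_real n hn lam c hc0 hc hl
    (fun k => ∫ x in (0:ℝ)..Real.pi, y x * e k x) (∫ x in (0:ℝ)..Real.pi, ‖y x‖)
    (coeff_bound y hy.continuous e he hb)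
  specialize main ?_ ?_ ?_
  rotate_right
  · obtain ⟨g, a1, a2, a3, a4, -⟩ := main
    exact ⟨g, _, a1, a2, a3, a4 (by simp [hedef])⟩
  · intro k
    apply coeff_rec y hy c lam hode e (fun x => k * Complex.cos (k * x)) k he hcos
    · exact hasDeriv_sin k
    · intro x
      refine ((hasDeriv_cos k x).const_mul (k:ℂ)).congr_deriv ?_
      show _ = -(k:ℂ)^2 * Complex.sin (k * x)
      ring
    · simp [hedef, y0]
    · simp [hedef, ypi, Complex.sin_int_mul_pi]
  · intro k
    have : ∀ x, y x * e (-k) x = - (y x * e k x) := by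
      intro x; simp [hedef, Complex.sin_neg]
    simp only [this, intervalIntegral.integral_neg, norm_neg]
  · by_contra! hz
    have h1 := coeff_zero y hy.continuous e he hcos hz 1
    obtain ⟨x, hx, hyx⟩ := hne
    have h2 := h1 x hx
    rcases eq_or_lt_of_le hx.1 with h | h
    · exact hyx (h ▸ y0)
    rcases eq_or_lt_of_le hx.2 with h' | h'
    · exact hyx (h' ▸ ypi)
    have h3 : e 1 x ≠ 0 := by
      simp only [hedef, Int.cast_one, one_mul]
      rw [← Complex.ofReal_sin]
      exact_mod_cast (Real.sin_pos_of_pos_of_lt_pi h h').ne'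
    exact (mul_ne_zero hyx h3) h2

lemma neumann_seq (n : ℕ) (hn : 2 ≤ n) (lam c : ℝ) (hc0 : 0 < c) (hc : c < 1)
    (hl : |lam - (2 * (n : ℝ)) ^ 2| ≤ 2 * c) (hd : neumannEV c (lam : ℂ)) :
    ∃ (g : ℕ → ℝ) (K : ℝ), (∀ k, |g k| ≤ K) ∧
      (∀ j : ℕ, (lam - 4 * ((j:ℝ)+1)^2) * g (j+1) = c * (g (j+2) - g j)) ∧
      (∃ j, g j ≠ 0) ∧ lam * g 0 = 2 * c * g 1 := by
  obtain ⟨y, hy, hne, hode, y0, ypi⟩ := hd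
  set e : ℤ → ℝ → ℂ := fun k x => Complex.cos (k * x) with hedef
  have he : ∀ k, Continuous (e k) := by intro k; simp only [hedef]; fun_prop
  have hcos : ∀ k x, 2 * (Real.cos x : ℂ) * e k x = e (k+1) x + e (k-1) x := by
    intro k x
    simp only [hedef]
    push_cast
    rw [add_mul, sub_mul, one_mul, Complex.cos_add, Complex.cos_sub]
    ring
  have hb : ∀ k x, ‖e k x‖ ≤ 1 := by
    intro k x
    simp only [hedef]
    rw [show (k:ℂ) * (x:ℂ) = ((k * x : ℝ) : ℂ) by push_cast; rfl, ← Complex.ofReal_cos, Complex.norm_real]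
    exact Real.abs_cos_le_one _
  have hsym : ∀ k x, y x * e (-k) x = y x * e k x := by
    intro k x; simp [hedef, Complex.cos_neg]
  have main := get_real n hn lam c hc0 hc hl
    (fun k => ∫ x in (0:ℝ)..Real.pi, y x * e k x) (∫ x in (0:ℝ)..Real.pi, ‖y x‖)
    (coeff_bound y hy.continuous e he hb)
  specialize main ?_ ?_ ?_
  rotate_right
  · obtain ⟨g, a1, a2, a3, -, a4⟩ := main
    exact ⟨g, _, a1, a2, a3, a4 (by simp only [hsym])⟩
  · intro k
    apply coeff_rec y hy c lam hode e (fun x => -(k * Complex.sin (k * x))) k he hcos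
    · exact hasDeriv_cos k
    · intro x
      refine ((hasDeriv_sin k x).const_mul (k:ℂ)).neg.congr_deriv ?_
      show _ = -(k:ℂ)^2 * Complex.cos (k * x)
      ring
    · simp [y0]
    · simp [ypi, Complex.sin_int_mul_pi]
  · intro k
    simp only [hsym]
  · by_contra! hz
    have h1 := coeff_zero y hy.continuous e he hcos hz 0
    obtain ⟨x, hx, hyx⟩ := hne
    have h2 := h1 x hx
    simp [hedef] at h2
    exact hyx h2

/-- For small `c`: near `(2n)²` the periodic-Dirichlet eigenvalue is below the
periodic-Neumann one iff `n` is even. -/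
theorem stmt16 (n : ℕ) (hn : 2 ≤ n) :
    ∃ c₀ > (0 : ℝ), ∀ c ∈ Set.Ioo (0 : ℝ) c₀, ∀ lam mu : ℝ,
      mathieuEV c 0 (lam : ℂ) → dirichletEV c (lam : ℂ) →
      |lam - (2 * (n : ℝ)) ^ 2| ≤ 2 * c →
      mathieuEV c 0 (mu : ℂ) → neumannEV c (mu : ℂ) →
      |mu - (2 * (n : ℝ)) ^ 2| ≤ 2 * c →
      ((Even n → lam < mu) ∧ (Odd n → mu < lam)) := by
  refine ⟨1, one_pos, ?_⟩
  rintro c ⟨hc0, hc⟩ lam mu - hd hl - hN hm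
  obtain ⟨g, K, g1, g2, g3, g4⟩ := dirichlet_seq n hn lam c hc0 hc hl hd
  obtain ⟨h, L, h1, h2, h3, h4⟩ := neumann_seq n hn mu c hc0 hc hm hN
  have := core n hn lam mu c hc0 hc hl hm g h K L g1 h1 g2 h2 g4 h4 g3 h3
  constructor
  · intro he
    rw [he.neg_one_pow] at this; linarith
  · intro ho
    rw [ho.neg_one_pow] at this; linarith
end
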